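/- Let 𝔸₁ denote the set of positive integers all of whose prime divisors are congruent to 1 modulo 4, and ω(n) the number of distinct prime divisors of n. Fix constants 0 < a < b and c > 0. Then there exist positive constants C₁, C₂ and Λ₀ such that for all real Λ ≥ Λ₀ and all positive integers K with K ≤ c·log log Λ, the cardinality of S_{Λ,K} := { ℓ ∈ ℕ : aΛ² ≤ ℓ ≤ bΛ², ℓ ∈ 𝔸₁, ω(ℓ) = K } satisfies C₁ · (Λ²/log Λ) · ((½ log log Λ)^{K−1}/(K−1)!) ≤ |S_{Λ,K}| ≤ C₂ · (Λ²/log Λ) · ((½ log log Λ)^{K−1}/(K−1)!). -/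

import Mathlib

open Real

/-- The set of positive integers all of whose prime divisors are ≡ 1 (mod 4). -/
def A1 : Set ℕ := {n : ℕ | 0 < n ∧ ∀ p : ℕ, p.Prime → p ∣ n → p % 4 = 1}

/-- One half of the Fejér kernel of order `T`, as a cosine transform of a triangle function. -/
noncomputable def fejerKernel (T v : ℝ) : ℝ := ∫ t in (0 : ℝ)..T, (1 - t / T) * cos (t * v)

lemma fejerKernel_eq {T v : ℝ} (hT : 0 < T) (hv : v ≠ 0) :
    fejerKernel T v = (1 - cos (T * v)) / (T * v ^ 2) := by
  have h : ∀ t ∈ Set.uIcc 0 T, HasDerivAt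
      (fun t => (1 - t / T) * (sin (t * v) / v) - cos (t * v) / (T * v ^ 2))
      ((1 - t / T) * cos (t * v)) t := by
    intro t _
    have h1 : HasDerivAt (fun t : ℝ => t * v) v t := by simpa using (hasDerivAt_id t).mul_const v
    have h2 : HasDerivAt (fun t : ℝ => 1 - t / T) (-(1 / T)) t := by
      simpa using ((hasDerivAt_id t).div_const T).const_sub 1
    have h3 := (h2.mul (h1.sin.div_const v)).sub (h1.cos.div_const (T * v ^ 2))
    convert! h3 using 1
    field_simp
    ring
  rw [fejerKernel, intervalIntegral.integral_eq_sub_of_hasDerivAt h]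
  · simp [hT.ne']
    ring
  · exact Continuous.intervalIntegrable (by fun_prop) _ _

lemma fejerKernel_nonneg {T : ℝ} (hT : 0 < T) (v : ℝ) : 0 ≤ fejerKernel T v := by
  rcases eq_or_ne v 0 with rfl | hv
  · refine intervalIntegral.integral_nonneg hT.le fun t ht => ?_
    simp only [mul_zero, cos_zero, mul_one, sub_nonneg]
    exact div_le_one_of_le₀ ht.2 hT.le
  · rw [fejerKernel_eq hT hv]
    have := cos_le_one (T * v)
    have : 0 ≤ 1 - cos (T * v) := by linarith
    positivity

lemma fejerKernel_le {T : ℝ} (hT : 0 < T) (v : ℝ) : fejerKernel T v ≤ T := by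
  have : fejerKernel T v ≤ ∫ _ in (0 : ℝ)..T, (1 : ℝ) := by
    refine intervalIntegral.integral_mono_on hT.le
      (Continuous.intervalIntegrable (by fun_prop) _ _) (by simp) fun t ht => ?_
    have h0 : 0 ≤ t / T := div_nonneg ht.1 hT.le
    have h1 : 0 ≤ 1 - t / T := sub_nonneg.2 (div_le_one_of_le₀ ht.2 hT.le)
    nlinarith [cos_le_one (t * v)]
  simpa using this

lemma fejerKernel_le_div {T v : ℝ} (hT : 0 < T) (hv : v ≠ 0) :
    fejerKernel T v ≤ 2 / (T * v ^ 2) := by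
  rw [fejerKernel_eq hT hv]
  have := neg_one_le_cos (T * v)
  gcongr
  linarith

lemma fejerKernel_ge {T v : ℝ} (hT : 0 < T) (hv : |v| ≤ 1 / T) : T / 4 ≤ fejerKernel T v := by
  have h : ∫ t in (0 : ℝ)..T, (1 - t / T) * (1 / 2) ≤ fejerKernel T v := by
    refine intervalIntegral.integral_mono_on hT.le
      (Continuous.intervalIntegrable (by fun_prop) _ _)
      (Continuous.intervalIntegrable (by fun_prop) _ _) fun t ht => ?_
    have h1 : 0 ≤ 1 - t / T := sub_nonneg.2 (div_le_one_of_le₀ ht.2 hT.le)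
    have h2 : |t * v| ≤ 1 := by
      rw [abs_mul, abs_of_nonneg ht.1]
      calc t * |v| ≤ T * (1 / T) := mul_le_mul ht.2 hv (abs_nonneg _) hT.le
        _ = 1 := by field_simp
    have h3 : 1 / 2 ≤ cos (t * v) := by
      have h4 := one_sub_sq_div_two_le_cos (x := t * v)
      have h5 : (t * v) ^ 2 ≤ 1 := by rw [← sq_abs]; exact pow_le_one₀ (abs_nonneg _) h2
      linarith
    gcongr
  have h2 : ∫ t in (0 : ℝ)..T, (1 - t / T) * (1 / 2) = T / 4 := by
    rw [intervalIntegral.integral_mul_const, intervalIntegral.integral_sub (by simp)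
      (Continuous.intervalIntegrable (by fun_prop) _ _), intervalIntegral.integral_div,
      integral_id]
    simp
    field_simp
    ring
  linarith

lemma hasSum_mul_fejerKernel {g : ℕ → ℝ} {s T : ℝ} (hs : s ≠ 0)
    (hg : LSeriesSummable (fun n => (g n : ℂ)) s) (y : ℝ) :
    HasSum (fun n : ℕ => g n * (n : ℝ) ^ (-s) * fejerKernel T (y - log n))
      (∫ t in (0 : ℝ)..T, ((1 - t / T : ℝ) : ℂ) *
        (Complex.exp ((t * y : ℝ) * Complex.I) *
          LSeries (fun n => (g n : ℂ)) (s + t * Complex.I))).re := by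
  set F : ℕ → ℝ → ℂ := fun n t => ((1 - t / T : ℝ) : ℂ) * (Complex.exp ((t * y : ℝ) * Complex.I) *
    LSeries.term (fun n => (g n : ℂ)) (s + t * Complex.I) n)
  have hterm : ∀ n t, F n t = ((g n * (n : ℝ) ^ (-s) * (1 - t / T) : ℝ) : ℂ) *
      Complex.exp ((t * (y - log n) : ℝ) * Complex.I) := by
    intro n t
    rcases eq_or_ne n 0 with rfl | hn
    · simp [F, Real.zero_rpow (neg_ne_zero.2 hs)]
    · have hn' : (n : ℂ) ≠ 0 := by exact_mod_cast hn
      have hlog : Complex.log n = (log n : ℝ) := (Complex.natCast_log).symm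
      simp only [F, LSeries.term_of_ne_zero hn]
      have hpow : (((n : ℝ) ^ (-s) : ℝ) : ℂ) = ((n : ℂ) ^ (s : ℂ))⁻¹ := by
        rw [Complex.ofReal_cpow (Nat.cast_nonneg n), Complex.ofReal_neg, Complex.ofReal_natCast,
          Complex.cpow_neg]
      rw [Complex.cpow_add _ _ hn', Complex.ofReal_mul (g n * _), Complex.ofReal_mul (g n), hpow,
        Complex.cpow_def_of_ne_zero hn' (t * Complex.I), hlog]
      have he : Complex.exp ((t * (y - log n) : ℝ) * Complex.I) =
          Complex.exp ((t * y : ℝ) * Complex.I) / Complex.exp ((log n : ℝ) * (t * Complex.I)) := by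
        rw [← Complex.exp_sub]
        congr 1
        push_cast
        ring
      rw [he]
      field_simp
  have hre : ∀ n, (∫ t in (0 : ℝ)..T, F n t).re = g n * (n : ℝ) ^ (-s) *
      fejerKernel T (y - log n) := by
    intro n
    have hint : IntervalIntegrable (F n) MeasureTheory.volume 0 T := by
      apply Continuous.intervalIntegrable
      simp only [funext (hterm n)]
      fun_prop
    rw [← Complex.reCLM_apply, ← Complex.reCLM.intervalIntegral_comp_comm hint, fejerKernel,
      ← intervalIntegral.integral_const_mul]
    refine intervalIntegral.integral_congr fun t _ => ?_
    simp only [hterm, Complex.reCLM_apply, Complex.re_ofReal_mul, Complex.exp_ofReal_mul_I_re]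
    ring
  have hsum : HasSum (fun n => ∫ t in (0 : ℝ)..T, F n t) (∫ t in (0 : ℝ)..T,
      ((1 - t / T : ℝ) : ℂ) * (Complex.exp ((t * y : ℝ) * Complex.I) *
          LSeries (fun n => (g n : ℂ)) (s + t * Complex.I))) := by
    have hsummable : ∀ t : ℝ, LSeriesSummable (fun n => (g n : ℂ)) (s + t * Complex.I) := by
      intro t
      exact hg.of_re_le_re (by simp)
    refine intervalIntegral.hasSum_integral_of_dominated_convergence
      (fun n t => |1 - t / T| * ‖LSeries.term (fun n => (g n : ℂ)) s n‖) ?_ ?_ ?_ ?_ ?_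
    · intro n
      apply Continuous.aestronglyMeasurable
      simp only [funext (hterm n)]
      fun_prop
    · intro n
      refine Filter.Eventually.of_forall fun t _ => ?_
      simp only [F, norm_mul, Complex.norm_exp_ofReal_mul_I, one_mul, Complex.norm_real,
        Real.norm_eq_abs]
      gcongr
      rw [LSeries.norm_term_eq, LSeries.norm_term_eq]
      simp
    · exact Filter.Eventually.of_forall fun t _ => hg.norm.mul_left _
    · simp_rw [tsum_mul_left]
      exact Continuous.intervalIntegrable (by fun_prop) _ _
    · refine Filter.Eventually.of_forall fun t _ => ?_
      exact ((hsummable t).hasSum.mul_left _).mul_left _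
  have := Complex.hasSum_re hsum
  simpa only [hre] using this

open Filter Topology in
lemma tendsto_intervalIntegral_exp_mul (φ : ℝ → ℂ) {T : ℝ} (hT : 0 ≤ T) :
    Tendsto (fun y : ℝ => ∫ t in (0 : ℝ)..T, Complex.exp ((t * y : ℝ) * Complex.I) * φ t)
      atTop (𝓝 0) := by
  have h := Real.tendsto_integral_exp_smul_cocompact ((Set.Ioc 0 T).indicator φ)
  have h2 : Tendsto (fun y : ℝ => -(2 * π)⁻¹ * y) atTop (cocompact ℝ) := by
    have h3 : Tendsto (fun y : ℝ => -(2 * π)⁻¹ * y) atTop atBot :=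
      tendsto_id.const_mul_atTop_of_neg (by simp [pi_pos])
    exact h3.mono_right atBot_le_cocompact
  refine (h.comp h2).congr fun y => ?_
  simp only [Function.comp_apply]
  rw [intervalIntegral.integral_of_le hT, ← MeasureTheory.integral_indicator measurableSet_Ioc]
  refine MeasureTheory.integral_congr_ae (Eventually.of_forall fun t => ?_)
  simp only [Set.indicator_apply]
  split_ifs
  · rw [Circle.smul_def, Real.fourierChar_apply, smul_eq_mul]
    congr 3
    have := pi_pos
    push_cast
    field_simp
  · simp

/-- The integers `n ≥ 1` with `|y - log n| ≤ δ`. -/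
noncomputable def logWindow (y δ : ℝ) : Finset ℕ :=
  (Finset.Icc 1 ⌊exp (y + δ)⌋₊).filter fun n => |y - log n| ≤ δ

lemma mem_logWindow {y δ : ℝ} {n : ℕ} : n ∈ logWindow y δ ↔ 1 ≤ n ∧ |y - log n| ≤ δ := by
  simp only [logWindow, Finset.mem_filter, Finset.mem_Icc]
  refine ⟨fun h => ⟨h.1.1, h.2⟩, fun h => ⟨⟨h.1, Nat.le_floor ?_⟩, h.2⟩⟩
  rw [← log_le_iff_le_exp (by exact_mod_cast h.1)]
  linarith [(abs_le.1 h.2).1]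

lemma exp_mul_le_sum_inv {ε y : ℝ} (hε : 0 < ε) (hy : 2 ≤ ε * exp y) :
    ε / 2 * exp (-ε) ≤ ∑ n ∈ logWindow y ε, (n : ℝ)⁻¹ := by
  have hsub : Finset.Icc ⌈exp y⌉₊ ⌊exp (y + ε)⌋₊ ⊆ logWindow y ε := by
    intro n hn
    rw [Finset.mem_Icc] at hn
    have h1 : exp y ≤ n := Nat.ceil_le.1 hn.1
    have h2 : (n : ℝ) ≤ exp (y + ε) := (Nat.le_floor_iff (exp_pos _).le).1 hn.2
    have h0 : (0 : ℝ) < n := (exp_pos y).trans_le h1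
    rw [mem_logWindow]
    refine ⟨by exact_mod_cast h0, ?_⟩
    have h3 := (le_log_iff_exp_le h0).2 h1
    have h4 := (log_le_iff_le_exp h0).2 h2
    rw [abs_le]
    constructor <;> linarith
  have hcard : ε / 2 * exp y ≤ ((Finset.Icc ⌈exp y⌉₊ ⌊exp (y + ε)⌋₊).card : ℝ) := by
    rw [Nat.card_Icc]
    have h1 : (⌈exp y⌉₊ : ℝ) < exp y + 1 := Nat.ceil_lt_add_one (exp_pos _).le
    have h2 : exp (y + ε) < (⌊exp (y + ε)⌋₊ : ℝ) + 1 := Nat.lt_floor_add_one _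
    have h3 : exp y * (1 + ε) ≤ exp (y + ε) := by
      rw [exp_add]
      have := add_one_le_exp ε
      gcongr
      linarith
    have h4 : (⌊exp (y + ε)⌋₊ : ℝ) + 1 - ⌈exp y⌉₊ ≤
        ((⌊exp (y + ε)⌋₊ + 1 - ⌈exp y⌉₊ : ℕ) : ℝ) := by
      rw [sub_le_iff_le_add]
      exact_mod_cast le_tsub_add
    nlinarith
  calc ε / 2 * exp (-ε) = (ε / 2 * exp y) * exp (-(y + ε)) := by
        rw [mul_assoc, ← exp_add]; congr 2; ring
    _ ≤ ((Finset.Icc ⌈exp y⌉₊ ⌊exp (y + ε)⌋₊).card : ℝ) * exp (-(y + ε)) := by gcongr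
    _ = ∑ n ∈ Finset.Icc ⌈exp y⌉₊ ⌊exp (y + ε)⌋₊, exp (-(y + ε)) := by simp
    _ ≤ ∑ n ∈ Finset.Icc ⌈exp y⌉₊ ⌊exp (y + ε)⌋₊, (n : ℝ)⁻¹ := by
        refine Finset.sum_le_sum fun n hn => ?_
        rw [Finset.mem_Icc] at hn
        have h1 : exp y ≤ n := Nat.ceil_le.1 hn.1
        have h2 : (n : ℝ) ≤ exp (y + ε) := (Nat.le_floor_iff (exp_pos _).le).1 hn.2
        rw [exp_neg]
        exact inv_anti₀ ((exp_pos y).trans_le h1) h2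
    _ ≤ _ := Finset.sum_le_sum_of_subset_of_nonneg hsub fun n _ _ => by positivity

open Filter Topology in
/-- A lower-bound form of the Wiener–Ikehara theorem in logarithmic windows. -/
lemma exists_le_sum_logWindow {f : ℕ → ℝ} {A B : ℝ} {H : ℂ → ℂ} (hf : ∀ n, 0 ≤ f n) (hA : 0 < A)
    (hsum : ∀ s : ℝ, 1 < s → LSeriesSummable (fun n => (f n : ℂ)) s)
    (hH : ContinuousOn H {s | 1 ≤ s.re})
    (hHeq : ∀ s : ℂ, 1 < s.re → LSeries (fun n => ((f n - A : ℝ) : ℂ)) s = H s)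
    (hB : ∀ (y : ℝ) (u : Finset ℕ), ∑ n ∈ u, f n / n / (1 + (y - log n) ^ 2) ≤ B)
    {δ : ℝ} (hδ : 0 < δ) :
    ∃ c > 0, ∀ᶠ y in atTop, c ≤ ∑ n ∈ logWindow y δ, f n / n := by
  have hB0 : 0 ≤ B := by simpa using hB 0 ∅
  set D : ℝ := (1 + (δ ^ 2)⁻¹) * B with hD
  have hD0 : 0 ≤ D := by positivity
  set T : ℝ := 1 + 96 * D / A with hT
  have hT1 : 1 ≤ T := by rw [hT]; have : 0 ≤ 96 * D / A := by positivity
                         linarith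
  have hT0 : 0 < T := by linarith
  set R : ℝ → ℝ → ℝ := fun s y => (∫ t in (0 : ℝ)..T, ((1 - t / T : ℝ) : ℂ) *
    (Complex.exp ((t * y : ℝ) * Complex.I) * H ((max s 1 : ℝ) + t * Complex.I))).re with hR
  have hHc : Continuous fun p : ℝ × ℝ => H ((max p.1 1 : ℝ) + p.2 * Complex.I) := by
    exact hH.comp_continuous (by fun_prop) fun p => by simp
  have hpos : ∀ y n, 0 ≤ fejerKernel T (y - log n) := fun y n => fejerKernel_nonneg hT0 _
  have hupper : ∀ (s y : ℝ), 1 < s → ∀ u : Finset ℕ,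
      ∑ n ∈ u, f n * (n : ℝ) ^ (-s) * fejerKernel T (y - log n) ≤
        T * ∑ n ∈ logWindow y δ, f n / n + 2 / T * D := by
    intro s y hs u
    have key : ∀ n : ℕ, f n * (n : ℝ) ^ (-s) * fejerKernel T (y - log n) ≤
        (if n ∈ logWindow y δ then T * (f n / n) else 0) +
          2 / T * (1 + (δ ^ 2)⁻¹) * (f n / n / (1 + (y - log n) ^ 2)) := by
      intro n
      have hfn := hf n
      rcases Nat.eq_zero_or_pos n with rfl | hn
      · rw [Nat.cast_zero, Real.zero_rpow (by linarith)]
        simp [mem_logWindow]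
      have hn1 : (1 : ℝ) ≤ n := by exact_mod_cast hn
      have h1 : f n * (n : ℝ) ^ (-s) ≤ f n / n := by
        rw [div_eq_mul_inv, ← Real.rpow_neg_one]
        gcongr
      have h2 : f n * (n : ℝ) ^ (-s) * fejerKernel T (y - log n) ≤
          f n / n * fejerKernel T (y - log n) := by gcongr; exact hpos y n
      refine h2.trans ?_
      split_ifs with hw
      · have h3 : f n / n * fejerKernel T (y - log n) ≤ T * (f n / n) := by
          rw [mul_comm T]; gcongr; exact fejerKernel_le hT0 _
        have h4 : 0 ≤ 2 / T * (1 + (δ ^ 2)⁻¹) * (f n / n / (1 + (y - log n) ^ 2)) := by positivity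
        linarith
      · have hv : δ < |y - log n| := by
          by_contra! hcon
          exact hw (mem_logWindow.2 ⟨hn, hcon⟩)
        have hv0 : y - log n ≠ 0 := abs_pos.1 (hδ.trans hv)
        have hv2 : δ ^ 2 ≤ (y - log n) ^ 2 := by
          rw [← sq_abs (y - log n)]; gcongr
        have h5 : 2 / (T * (y - log n) ^ 2) ≤
            2 / T * (1 + (δ ^ 2)⁻¹) * (1 / (1 + (y - log n) ^ 2)) := by
          set w := (y - log n) ^ 2
          have hw0 : 0 < w := by positivity
          have : 1 / w ≤ (1 + (δ ^ 2)⁻¹) * (1 / (1 + w)) := by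
            rw [mul_one_div, div_le_div_iff₀ hw0 (by positivity)]
            have : 1 ≤ (δ ^ 2)⁻¹ * w := by
              rw [← div_eq_inv_mul, le_div_iff₀ (by positivity)]; linarith
            nlinarith
          calc 2 / (T * w) = 2 / T * (1 / w) := by field_simp
            _ ≤ 2 / T * ((1 + (δ ^ 2)⁻¹) * (1 / (1 + w))) := by gcongr
            _ = _ := by ring
        calc f n / n * fejerKernel T (y - log n)
            ≤ f n / n * (2 / T * (1 + (δ ^ 2)⁻¹) * (1 / (1 + (y - log n) ^ 2))) := by
              gcongr; exact (fejerKernel_le_div hT0 hv0).trans h5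
          _ = _ := by ring
    calc _ ≤ ∑ n ∈ u, ((if n ∈ logWindow y δ then T * (f n / n) else 0) +
          2 / T * (1 + (δ ^ 2)⁻¹) * (f n / n / (1 + (y - log n) ^ 2))) :=
        Finset.sum_le_sum fun n _ => key n
      _ ≤ T * ∑ n ∈ logWindow y δ, f n / n + 2 / T * D := by
        rw [Finset.sum_add_distrib, ← Finset.mul_sum, ← Finset.sum_filter, ← Finset.mul_sum, hD,
          ← mul_assoc]
        gcongr
        · intro n hn _
          exact div_nonneg (hf n) (Nat.cast_nonneg n)
        · exact fun n hn => (Finset.mem_filter.1 hn).2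
        · exact hB y u
  have hineq : ∀ s y : ℝ, 1 < s →
      ∑ n ∈ logWindow y (1 / T), A * (n : ℝ) ^ (-s) * (T / 4) + R s y ≤
        T * ∑ n ∈ logWindow y δ, f n / n + 2 / T * D := by
    intro s y hs
    have hs0 : s ≠ 0 := by linarith
    have hone : LSeriesSummable (fun n => ((1 : ℝ) : ℂ)) (s : ℂ) := by
      simpa using! (LSeriesSummable_one_iff (s := (s : ℂ))).2 (by simpa using hs)
    have hconst : LSeriesSummable (fun n => ((A : ℝ) : ℂ)) (s : ℂ) := by
      convert! hone.smul (A : ℂ) using 1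
      ext n
      simp
    have hg : LSeriesSummable (fun n => ((f n - A : ℝ) : ℂ)) (s : ℂ) := by
      convert! (hsum s hs).sub hconst using 1
      ext n
      simp
    have h1 := hasSum_mul_fejerKernel (T := T) hs0 (hsum s hs) y
    have h2 := hasSum_mul_fejerKernel (T := T) hs0 hconst y
    have h3 := hasSum_mul_fejerKernel (T := T) hs0 hg y
    have hRs : (∫ t in (0 : ℝ)..T, ((1 - t / T : ℝ) : ℂ) *
        (Complex.exp ((t * y : ℝ) * Complex.I) *
          LSeries (fun n => ((f n - A : ℝ) : ℂ)) (s + t * Complex.I))).re = R s y := by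
      simp only [hR]
      congr 1
      refine intervalIntegral.integral_congr fun t _ => ?_
      rw [hHeq _ (by simpa using hs), max_eq_left hs.le]
    rw [hRs] at h3
    have h4 := (h3.add h2).unique (by convert! h1 using 2; ring)
    have h5 : ∑ n ∈ logWindow y (1 / T), A * (n : ℝ) ^ (-s) * (T / 4) ≤
        ∑ n ∈ logWindow y (1 / T), A * (n : ℝ) ^ (-s) * fejerKernel T (y - log n) := by
      refine Finset.sum_le_sum fun n hn => ?_
      gcongr
      exact fejerKernel_ge hT0 (mem_logWindow.1 hn).2
    have h6 := sum_le_hasSum (logWindow y (1 / T))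
      (fun n _ => mul_nonneg (by positivity) (hpos y n)) h2
    have h7 := hasSum_le_of_sum_le h1 (hupper s y hs)
    linarith
  have hineq1 : ∀ y : ℝ, A * (T / 4) * ∑ n ∈ logWindow y (1 / T), (n : ℝ)⁻¹ + R 1 y ≤
        T * ∑ n ∈ logWindow y δ, f n / n + 2 / T * D := by
    intro y
    have hlim : Tendsto (fun s : ℝ =>
        ∑ n ∈ logWindow y (1 / T), A * (n : ℝ) ^ (-s) * (T / 4) + R s y) (𝓝[>] 1)
        (𝓝 (∑ n ∈ logWindow y (1 / T), A * (n : ℝ) ^ (-(1 : ℝ)) * (T / 4) + R 1 y)) := by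
      refine Tendsto.mono_left (Continuous.tendsto ?_ 1) nhdsWithin_le_nhds
      refine Continuous.add ?_ ?_
      · refine continuous_finsetSum _ fun n hn => ?_
        have : (n : ℝ) ≠ 0 := by
          have := (mem_logWindow.1 hn).1
          positivity
        fun_prop (disch := assumption)
      · refine Complex.continuous_re.comp ?_
        refine intervalIntegral.continuous_parametric_intervalIntegral_of_continuous' ?_ _ _
        exact Continuous.mul (by fun_prop) (Continuous.mul (by fun_prop) hHc)
    refine le_of_eq_of_le ?_ (le_of_tendsto hlim
      (eventually_nhdsWithin_of_forall fun s hs => hineq s y hs))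
    rw [Finset.mul_sum]
    congr 1
    refine Finset.sum_congr rfl fun n _ => ?_
    rw [Real.rpow_neg_one]
    ring
  have hRlim : Tendsto (fun y => R 1 y) atTop (𝓝 0) := by
    have := tendsto_intervalIntegral_exp_mul
      (fun t => ((1 - t / T : ℝ) : ℂ) * H ((max 1 1 : ℝ) + t * Complex.I)) hT0.le
    have h2 := (Complex.continuous_re.tendsto 0).comp this
    rw [Complex.zero_re] at h2
    refine h2.congr fun y => ?_
    simp only [hR, Function.comp_apply]
    congr 1
    refine intervalIntegral.integral_congr fun t _ => ?_
    ring
  refine ⟨A / (96 * T), by positivity, ?_⟩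
  have hev : ∀ᶠ y : ℝ in atTop, 2 ≤ 1 / T * exp y :=
    (tendsto_exp_atTop.const_mul_atTop (by positivity)).eventually_ge_atTop 2
  filter_upwards [hRlim.eventually (lt_mem_nhds (show -(A / 96) < 0 by
    rw [neg_lt_zero]; positivity)), hev] with y hy1 hy2
  have h1 := exp_mul_le_sum_inv (by positivity) hy2
  have h2 := hineq1 y
  have h3 : 2 / T * D ≤ A / 48 := by
    rw [div_mul_eq_mul_div, div_le_iff₀ hT0, hT]
    field_simp
    nlinarith
  have h4 : (1 : ℝ) / 3 ≤ exp (-(1 / T)) := by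
    have : exp (-1) ≤ exp (-(1 / T)) := by
      gcongr
      rw [div_le_one hT0]; exact hT1
    have h5 := exp_one_lt_three
    rw [exp_neg] at this
    have : (1 : ℝ) / 3 ≤ (exp 1)⁻¹ := by
      rw [one_div]; exact inv_anti₀ (exp_pos _) h5.le
    linarith
  have h5 : A / 24 ≤ A * (T / 4) * ∑ n ∈ logWindow y (1 / T), (n : ℝ)⁻¹ := by
    calc A / 24 = A * (T / 4) * (1 / T / 2 * (1 / 3)) := by field_simp; norm_num
      _ ≤ _ := by gcongr; exact le_trans (by gcongr) h1
  have h6 : A / 96 ≤ T * ∑ n ∈ logWindow y δ, f n / n := by linarith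
  rw [div_le_iff₀ (by positivity)]
  nlinarith

lemma summable_inv_one_add_sq_int : Summable fun j : ℤ => (1 + (j : ℝ) ^ 2)⁻¹ := by
  have h1 : Summable fun j : ℤ => 1 / (j : ℝ) ^ 2 :=
    (Real.summable_one_div_int_pow (p := 2)).2 one_lt_two
  have h2 : Summable fun j : ℤ => if j = 0 then (1 : ℝ) else 0 :=
    (hasSum_ite_eq 0 1).summable
  refine (h1.add h2).of_nonneg_of_le (fun j => by positivity) fun j => ?_
  split_ifs with hj
  · simp [hj]
  · have : (0 : ℝ) < (j : ℝ) ^ 2 := by positivity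
    rw [add_zero, one_div]
    exact inv_anti₀ this (by linarith)

open ArithmeticFunction (vonMangoldt) in
lemma exists_sum_vonMangoldt_div_le : ∃ B : ℝ, ∀ (y : ℝ) (u : Finset ℕ),
    ∑ n ∈ u, vonMangoldt n / n / (1 + (y - log n) ^ 2) ≤ B := by
  set φ : ℤ → ℝ := fun j => (1 + (j : ℝ) ^ 2)⁻¹ with hφ
  refine ⟨3 * (log 4 + 4) * exp 1 * ∑' j, φ j, fun y u => ?_⟩
  have hφ0 : ∀ j, 0 ≤ φ j := fun j => by positivity
  set m : ℤ := ⌊y⌋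
  set g : ℕ → ℤ := fun n => ⌊log n⌋
  have hlog4 : 0 ≤ log 4 + 4 := by positivity
  have hfib : ∀ k : ℤ, ∑ n ∈ u with g n = k, vonMangoldt n / n / (1 + (y - log n) ^ 2) ≤
      3 * (log 4 + 4) * exp 1 * φ (m - k) := by
    intro k
    have hpt : ∀ n ∈ u.filter (g · = k), vonMangoldt n / n / (1 + (y - log n) ^ 2) ≤
        vonMangoldt n * (exp (-k) * (3 * φ (m - k))) := by
      intro n hn
      have hk : ⌊log n⌋ = k := (Finset.mem_filter.1 hn).2
      have hΛ : 0 ≤ vonMangoldt n := ArithmeticFunction.vonMangoldt_nonneg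
      rcases Nat.eq_zero_or_pos n with rfl | hn0
      · simp
      have hn0' : (0 : ℝ) < n := by exact_mod_cast hn0
      have h1 : (n : ℝ)⁻¹ ≤ exp (-k) := by
        rw [exp_neg]
        refine inv_anti₀ (exp_pos _) ?_
        rw [← le_log_iff_exp_le hn0', ← hk]
        exact Int.floor_le _
      have h2 : (1 + (y - log n) ^ 2)⁻¹ ≤ 3 * φ (m - k) := by
        have h3 := Int.floor_le y
        have h4 := Int.lt_floor_add_one y
        have h5 := Int.floor_le (log n)
        have h6 := Int.lt_floor_add_one (log n)
        rw [hk] at h5 h6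
        simp only [hφ]
        rw [← div_eq_mul_inv, inv_eq_one_div, div_le_div_iff₀ (by positivity) (by positivity)]
        push_cast
        set a := y - log n
        set b : ℝ := (m : ℝ) - k
        have h7 : -1 ≤ b - a := by simp only [a, b, m]; linarith
        have h8 : b - a ≤ 1 := by simp only [a, b, m]; linarith
        nlinarith [sq_nonneg (a - (b - a))]
      rw [div_eq_mul_inv, div_eq_mul_inv, mul_assoc]
      gcongr
    have hsub : u.filter (fun n => g n = k ∧ n ≠ 0) ⊆ Finset.Ioc 0 ⌊exp (k + 1)⌋₊ := by
      intro n hn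
      obtain ⟨_, hk, hn0⟩ := Finset.mem_filter.1 hn
      have hn0' : 0 < n := Nat.pos_of_ne_zero hn0
      rw [Finset.mem_Ioc]
      refine ⟨hn0', Nat.le_floor ?_⟩
      rw [← log_le_iff_le_exp (by exact_mod_cast hn0'), ← hk]
      exact (Int.lt_floor_add_one _).le
    have hpsi : ∑ n ∈ u with g n = k, vonMangoldt n ≤ (log 4 + 4) * exp (k + 1) := by
      calc ∑ n ∈ u with g n = k, vonMangoldt n
          = ∑ n ∈ u with (g n = k ∧ n ≠ 0), vonMangoldt n := by
            rw [← Finset.filter_filter]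
            symm
            apply Finset.sum_filter_of_ne
            rintro n _ hn rfl
            simp at hn
        _ ≤ ∑ n ∈ Finset.Ioc 0 ⌊exp (k + 1)⌋₊, vonMangoldt n :=
            Finset.sum_le_sum_of_subset_of_nonneg hsub
              fun n _ _ => ArithmeticFunction.vonMangoldt_nonneg
        _ = Chebyshev.psi (exp (k + 1)) := rfl
        _ ≤ _ := Chebyshev.psi_le_const_mul_self (exp_pos _).le
    calc _ ≤ ∑ n ∈ u with g n = k, vonMangoldt n * (exp (-k) * (3 * φ (m - k))) :=
          Finset.sum_le_sum hpt
      _ = (∑ n ∈ u with g n = k, vonMangoldt n) * (exp (-k) * (3 * φ (m - k))) := by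
          rw [Finset.sum_mul]
      _ ≤ (log 4 + 4) * exp (k + 1) * (exp (-k) * (3 * φ (m - k))) := by
          have := hφ0 (m - k)
          gcongr
      _ = _ := by
          rw [exp_add, exp_neg]
          field_simp
  calc ∑ n ∈ u, vonMangoldt n / n / (1 + (y - log n) ^ 2)
      = ∑ k ∈ u.image g, ∑ n ∈ u with g n = k, vonMangoldt n / n / (1 + (y - log n) ^ 2) :=
        (Finset.sum_fiberwise_of_maps_to (fun n hn => Finset.mem_image_of_mem g hn) _).symm
    _ ≤ ∑ k ∈ u.image g, 3 * (log 4 + 4) * exp 1 * φ (m - k) :=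
        Finset.sum_le_sum fun k _ => hfib k
    _ = 3 * (log 4 + 4) * exp 1 * ∑ k ∈ u.image g, φ (m - k) := by rw [Finset.mul_sum]
    _ ≤ 3 * (log 4 + 4) * exp 1 * ∑' j, φ j := by
        gcongr
        rw [← (Equiv.subLeft m).tsum_eq φ]
        exact Summable.sum_le_tsum _ (fun k _ => hφ0 _)
          ((Equiv.subLeft m).summable_iff.2 summable_inv_one_add_sq_int)

open ArithmeticFunction.vonMangoldt in
lemma lseriesSummable_residueClass {q : ℕ} (a : ZMod q) {s : ℂ} (hs : 1 < s.re) :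
    LSeriesSummable (fun n => (residueClass a n : ℂ)) s :=
  LSeriesSummable_of_abscissaOfAbsConv_lt_re <|
    (abscissaOfAbsConv_residueClass_le_one a).trans_lt <| by exact_mod_cast hs

open ArithmeticFunction.vonMangoldt in
lemma exists_continuousOn_lseries_residueClass {q : ℕ} [NeZero q] {a : ZMod q} (ha : IsUnit a) :
    ∃ H : ℂ → ℂ, ContinuousOn H {s | 1 ≤ s.re} ∧ ∀ s : ℂ, 1 < s.re →
      LSeries (fun n => ((residueClass a n - (q.totient : ℝ)⁻¹ : ℝ) : ℂ)) s = H s := by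
  have hdiff := DirichletCharacter.differentiable_LFunctionTrivChar₁ 1
  have hcont : Continuous (dslope (DirichletCharacter.LFunctionTrivChar₁ 1) 1) := by
    rw [← continuousOn_univ, continuousOn_dslope Filter.univ_mem]
    exact ⟨hdiff.continuous.continuousOn, hdiff 1⟩
  refine ⟨fun s => LFunctionResidueClassAux a s -
      (q.totient : ℂ)⁻¹ * dslope (DirichletCharacter.LFunctionTrivChar₁ 1) 1 s,
    (continuousOn_LFunctionResidueClassAux a).sub (by fun_prop), fun s hs => ?_⟩
  have hs1 : s ≠ 1 := by rintro rfl; simp at hs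
  have hone : LSeriesSummable (1 : ℕ → ℂ) s := LSeriesSummable_one_iff.2 hs
  have h1 : LSeries (fun n => ((residueClass a n - (q.totient : ℝ)⁻¹ : ℝ) : ℂ)) s =
      LSeries (fun n => (residueClass a n : ℂ)) s - (q.totient : ℂ)⁻¹ * riemannZeta s := by
    rw [← LSeries_one_eq_riemannZeta hs, ← LSeries_smul,
      ← LSeries_sub (lseriesSummable_residueClass a hs) (hone.smul _)]
    congr 1
    ext n
    simp
  beta_reduce
  rw [h1, eqOn_LFunctionResidueClassAux ha hs, dslope_of_ne _ hs1, slope_def_field]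
  have h2 : DirichletCharacter.LFunctionTrivChar₁ 1 s = (s - 1) * riemannZeta s := by
    simp [DirichletCharacter.LFunctionTrivChar₁, hs1, DirichletCharacter.LFunctionTrivChar,
      DirichletCharacter.LFunction_modOne_eq]
  have h3 : DirichletCharacter.LFunctionTrivChar₁ 1 1 = 1 := by
    simp [DirichletCharacter.LFunctionTrivChar₁]
  rw [h2, h3]
  have : s - 1 ≠ 0 := sub_ne_zero.2 hs1
  field_simp
  ring

/-- The primes `p ≡ 1 (mod 4)` with `x ≤ p ≤ y`. -/
noncomputable def primesOneModFour (x y : ℝ) : Finset ℕ :=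
  {p ∈ Finset.range (⌊y⌋₊ + 1) | (p.Prime ∧ p % 4 = 1) ∧ x ≤ p ∧ (p : ℝ) ≤ y}

lemma mem_primesOneModFour {x y : ℝ} {p : ℕ} :
    p ∈ primesOneModFour x y ↔ (p.Prime ∧ p % 4 = 1) ∧ x ≤ p ∧ (p : ℝ) ≤ y := by
  simp only [primesOneModFour, Finset.mem_filter, Finset.mem_range, Nat.lt_succ_iff,
    and_iff_right_iff_imp]
  exact fun h => Nat.le_floor h.2.2

lemma natCast_zmod_four_eq_one_iff {n : ℕ} : (n : ZMod 4) = 1 ↔ n % 4 = 1 := by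
  simpa using ZMod.natCast_eq_natCast_iff' n 1 4

open ArithmeticFunction.vonMangoldt in
lemma residueClass_one_four_apply (n : ℕ) :
    residueClass (1 : ZMod 4) n = if n % 4 = 1 then ArithmeticFunction.vonMangoldt n else 0 := by
  simp [residueClass, Set.indicator_apply, natCast_zmod_four_eq_one_iff]

open ArithmeticFunction.vonMangoldt in
lemma exists_le_card_primesOneModFour {a b : ℝ} (ha : 0 < a) (hab : a < b) :
    ∃ c > 0, ∀ᶠ t in Filter.atTop, c * (t / log t) ≤ (primesOneModFour (a * t) (b * t)).card := by
  have hb : 0 < b := ha.trans hab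
  have hab' : log a < log b := log_lt_log ha hab
  set f := residueClass (1 : ZMod 4) with hf
  obtain ⟨H, hH, hHeq⟩ := exists_continuousOn_lseries_residueClass (a := (1 : ZMod 4)) isUnit_one
  obtain ⟨B, hB⟩ := exists_sum_vonMangoldt_div_le
  have htot : (0 : ℝ) < ((Nat.totient 4 : ℕ) : ℝ)⁻¹ := by
    have : 0 < Nat.totient 4 := Nat.totient_pos.2 (by norm_num)
    positivity
  set δ := (log b - log a) / 2 with hδ
  obtain ⟨c, hc, hev⟩ := exists_le_sum_logWindow (f := f) (B := B) (H := H) (δ := δ)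
    (residueClass_nonneg _) htot
    (fun s hs => lseriesSummable_residueClass _ (by simpa using hs)) hH hHeq
    (fun y u => (Finset.sum_le_sum fun n _ => by
      have := residueClass_le (1 : ZMod 4) n
      gcongr).trans (hB y u)) (by rw [hδ]; linarith)
  have hsum := summable_residueClass_non_primes_div (1 : ZMod 4)
  obtain ⟨s0, hs0⟩ := summable_iff_vanishing_norm.1 hsum (c / 2) (by positivity)
  obtain ⟨M, hM⟩ := s0.bddAbove
  refine ⟨c * a / 4, by positivity, ?_⟩
  set m := (log a + log b) / 2 with hm
  have h1 : Filter.Tendsto (fun t : ℝ => log t + m) Filter.atTop Filter.atTop :=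
    Filter.tendsto_atTop_add_const_right _ _ tendsto_log_atTop
  filter_upwards [h1.eventually hev, Filter.eventually_gt_atTop ((M + 1) / a),
    Filter.eventually_ge_atTop b, Filter.eventually_gt_atTop 1] with t ht htM htb ht1
  have ht0 : 0 < t := by linarith
  have hlt : 0 < log t := log_pos ht1
  have hwin : ∀ n ∈ logWindow (log t + m) δ, a * t ≤ n ∧ n ≤ b * t := by
    intro n hn
    obtain ⟨hn1, hn2⟩ := mem_logWindow.1 hn
    have hn0 : (0 : ℝ) < n := by exact_mod_cast hn1
    rw [abs_le] at hn2
    constructor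
    · rw [← log_le_log_iff (by positivity) hn0, log_mul ha.ne' ht0.ne']; linarith
    · rw [← log_le_log_iff hn0 (by positivity), log_mul hb.ne' ht0.ne']; linarith
  have hsplit : ∑ n ∈ logWindow (log t + m) δ, f n / n =
      ∑ n ∈ logWindow (log t + m) δ, (if n.Prime then 0 else f n) / n +
      ∑ n ∈ logWindow (log t + m) δ, (if n.Prime then f n else 0) / n := by
    rw [← Finset.sum_add_distrib]
    refine Finset.sum_congr rfl fun n _ => ?_
    split_ifs <;> simp
  have hnp : ∑ n ∈ logWindow (log t + m) δ, (if n.Prime then 0 else f n) / n ≤ c / 2 := by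
    refine ((le_abs_self _).trans (hs0 _ ?_).le)
    rw [Finset.disjoint_left]
    intro n hn hn'
    have := (hwin n hn).1
    have h2 : (n : ℝ) ≤ M := by exact_mod_cast hM hn'
    rw [div_lt_iff₀ ha] at htM
    linarith
  have hp : ∑ n ∈ logWindow (log t + m) δ, (if n.Prime then f n else 0) / n ≤
      (primesOneModFour (a * t) (b * t)).card * (2 * log t / (a * t)) := by
    rw [← nsmul_eq_mul, ← Finset.sum_const]
    refine (Finset.sum_le_sum (g := fun n : ℕ => if n ∈ primesOneModFour (a * t) (b * t) then
      2 * log t / (a * t) else 0) fun n hn => ?_).trans ?_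
    · obtain ⟨hn1, hn2⟩ := hwin n hn
      have hn0 : (0 : ℝ) < n := lt_of_lt_of_le (by positivity) hn1
      by_cases hpp : n.Prime
      · rw [if_pos hpp, hf, residueClass_one_four_apply]
        by_cases h4 : n % 4 = 1
        · rw [if_pos h4, if_pos (mem_primesOneModFour.2 ⟨⟨hpp, h4⟩, hn1, hn2⟩),
            ArithmeticFunction.vonMangoldt_apply_prime hpp]
          gcongr
          calc log n ≤ log (t * t) := log_le_log hn0 (hn2.trans (by gcongr))
            _ = 2 * log t := by rw [log_mul ht0.ne' ht0.ne']; ring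
        · rw [if_neg h4, if_neg (fun h => h4 (mem_primesOneModFour.1 h).1.2), zero_div]
      · rw [if_neg hpp, zero_div]
        split_ifs
        · positivity
        · rfl
    · rw [← Finset.sum_filter]
      refine Finset.sum_le_sum_of_subset_of_nonneg (fun n hn => (Finset.mem_filter.1 hn).2) ?_
      intros; positivity
  have h3 : c / 2 ≤ (primesOneModFour (a * t) (b * t)).card * (2 * log t / (a * t)) := by linarith
  rw [← mul_div_assoc, le_div_iff₀ (by positivity)] at h3
  rw [← mul_div_assoc, div_le_iff₀ hlt]
  nlinarith

open ArithmeticFunction.vonMangoldt in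
lemma summable_residueClass_div_rpow {q : ℕ} (a : ZMod q) {u : ℝ} (hu : 1 < u) :
    Summable fun n : ℕ => residueClass a n / (n : ℝ) ^ u :=
  LSeries.summable_real_of_abscissaOfAbsConv_lt <|
    (abscissaOfAbsConv_residueClass_le_one a).trans_lt <| mod_cast hu

open ArithmeticFunction.vonMangoldt in
lemma exists_abs_tsum_residueClass_sub_le {q : ℕ} [NeZero q] {a : ZMod q} (ha : IsUnit a) :
    ∃ C : ℝ, ∀ u ∈ Set.Ioc (1 : ℝ) 2,
      |∑' n : ℕ, residueClass a n / (n : ℝ) ^ u - (q.totient : ℝ)⁻¹ / (u - 1)| ≤ C := by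
  have H {x : ℝ} (hx : 1 < x) :
      ∑' n, residueClass a n / (n : ℝ) ^ x =
        (LFunctionResidueClassAux a x).re + (q.totient : ℝ)⁻¹ / (x - 1) := by
    refine Complex.ofReal_injective ?_
    simp only [Complex.ofReal_tsum, Complex.ofReal_div, Complex.ofReal_cpow (Nat.cast_nonneg _),
      Complex.ofReal_natCast, Complex.ofReal_add, Complex.ofReal_inv, Complex.ofReal_sub,
      Complex.ofReal_one]
    simp_rw [← LFunctionResidueClassAux_real ha hx,
      eqOn_LFunctionResidueClassAux ha <| Set.mem_ofPred.mpr (Complex.ofReal_re x ▸ hx),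
      sub_add_cancel, LSeries, LSeries.term]
    refine tsum_congr fun n ↦ ?_
    split_ifs with hn
    · simp only [hn, residueClass_apply_zero, Complex.ofReal_zero, zero_div]
    · rfl
  have hcont : ContinuousOn (fun x : ℝ ↦ (LFunctionResidueClassAux a x).re) (Set.Icc 1 2) :=
    Complex.continuous_re.continuousOn.comp (t := Set.univ)
      (continuousOn_LFunctionResidueClassAux a)
      (fun ⦃x⦄ a ↦ trivial) |>.comp Complex.continuous_ofReal.continuousOn fun x hx ↦ by
        simpa only [Set.mem_ofPred_eq, Complex.ofReal_re] using hx.1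
  obtain ⟨C, hC⟩ := isCompact_Icc.exists_bound_of_continuousOn hcont
  refine ⟨C, fun u hu => ?_⟩
  rw [H hu.1, add_sub_cancel_right]
  exact hC u (Set.mem_Icc_of_Ioc hu)

lemma integral_rpow_neg_exponent {x p q : ℝ} (hx : 1 < x) :
    ∫ u in p..q, (x ^ u)⁻¹ = ((x ^ p)⁻¹ - (x ^ q)⁻¹) / log x := by
  have hx0 : 0 < x := by linarith
  have hl : log x ≠ 0 := (log_pos hx).ne'
  have key : ∀ u ∈ Set.uIcc p q, HasDerivAt (fun u => - (x ^ u)⁻¹ / log x) ((x ^ u)⁻¹) u := by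
    intro u _
    have h1 := (((hasStrictDerivAt_const_rpow hx0 u).hasDerivAt.inv
      (rpow_pos_of_pos hx0 u).ne').neg).div_const (log x)
    have h2 := (rpow_pos_of_pos hx0 u).ne'
    refine h1.congr_deriv ?_
    field_simp
  rw [intervalIntegral.integral_eq_sub_of_hasDerivAt key]
  · ring
  · apply Continuous.intervalIntegrable
    have : ∀ u : ℝ, x ^ u ≠ 0 := fun u => (rpow_pos_of_pos hx0 u).ne'
    exact (continuous_const_rpow hx0.ne').inv₀ this

lemma hasSum_integral_dirichlet {f : ℕ → ℝ} (hf : ∀ n, 0 ≤ f n) {p q : ℝ} (hpq : p ≤ q)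
    (hs : Summable fun n : ℕ => f n / (n : ℝ) ^ p) (h0 : f 0 = 0) :
    HasSum (fun n : ℕ => ∫ u in p..q, f n / (n : ℝ) ^ u)
      (∫ u in p..q, ∑' n : ℕ, f n / (n : ℝ) ^ u) ∧
    ContinuousOn (fun u : ℝ => ∑' n : ℕ, f n / (n : ℝ) ^ u) (Set.Icc p q) := by
  have hcont : ∀ n : ℕ, Continuous fun u : ℝ => f n / (n : ℝ) ^ u := by
    intro n
    rcases n.eq_zero_or_pos with rfl | hn
    · simpa [h0] using continuous_const
    · have hn' : (0 : ℝ) < n := by exact_mod_cast hn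
      exact continuous_const.div (continuous_const_rpow hn'.ne')
        fun u => (rpow_pos_of_pos hn' u).ne'
  have hbd : ∀ (n : ℕ) (u : ℝ), p ≤ u → ‖f n / (n : ℝ) ^ u‖ ≤ f n / (n : ℝ) ^ p := by
    intro n u hu
    rcases n.eq_zero_or_pos with rfl | hn
    · simp [h0]
    · have hn' : (1 : ℝ) ≤ n := by exact_mod_cast hn
      rw [norm_of_nonneg (div_nonneg (hf n) (by positivity))]
      have := hf n
      gcongr
  have hcs : ContinuousOn (fun u : ℝ => ∑' n : ℕ, f n / (n : ℝ) ^ u) (Set.Icc p q) :=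
    continuousOn_tsum (fun n => (hcont n).continuousOn) hs fun n u hu => hbd n u hu.1
  refine ⟨intervalIntegral.hasSum_integral_of_dominated_convergence
    (fun n _ => f n / (n : ℝ) ^ p) (fun n => (hcont n).aestronglyMeasurable) (fun n => ?_) ?_ ?_ ?_,
    hcs⟩
  · refine Filter.Eventually.of_forall fun u hu => hbd n u ?_
    rw [Set.uIoc_of_le hpq] at hu
    exact hu.1.le
  · exact Filter.Eventually.of_forall fun _ _ => hs
  · exact intervalIntegrable_const
  · refine Filter.Eventually.of_forall fun u hu => Summable.hasSum ?_
    rw [Set.uIoc_of_le hpq] at hu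
    exact Summable.of_norm_bounded hs fun n => hbd n u hu.1.le

/-- A Mertens-type estimate from the behaviour of a Dirichlet series at its simple pole. -/
lemma exists_abs_sum_div_log_sub_le {f : ℕ → ℝ} {A C : ℝ} (hf : ∀ n, 0 ≤ f n) (h0 : f 0 = 0)
    (h1 : f 1 = 0) (hs : ∀ u : ℝ, 1 < u → Summable fun n : ℕ => f n / (n : ℝ) ^ u)
    (hA : 0 ≤ A)
    (hC : ∀ u ∈ Set.Ioc (1 : ℝ) 2, |∑' n : ℕ, f n / (n : ℝ) ^ u - A / (u - 1)| ≤ C) :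
    (∃ D : ℝ, ∀ X : ℝ, 3 ≤ X →
      |∑ n ∈ Finset.range (⌊X⌋₊ + 1), f n / (n * log n) - A * log (log X)| ≤ D) ∧
    ∃ D : ℝ, ∀ X : ℝ, 3 ≤ X →
      ∑ n ∈ Finset.range (⌊X⌋₊ + 1), f n / n ≤ D * log X := by
  have hC0 : 0 ≤ C := (abs_nonneg _).trans (hC 2 (by norm_num))
  set g : ℕ → ℝ := fun n => f n / log n with hg
  have hlog : ∀ n : ℕ, 0 ≤ log n := fun n => log_natCast_nonneg n
  have hg0 : ∀ n, 0 ≤ g n := fun n => div_nonneg (hf n) (hlog n)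
  have hgf : ∀ n, g n * log n = f n := by
    intro n
    rcases lt_or_ge n 2 with h | h
    · interval_cases n <;> simp [h0, h1]
    · have : 0 < log n := log_pos (by exact_mod_cast h)
      simp only [hg]; field_simp
  have hgs : ∀ u : ℝ, 1 < u → Summable fun n : ℕ => g n / (n : ℝ) ^ u := by
    intro u hu
    refine Summable.of_nonneg_of_le (fun n => div_nonneg (hg0 n) (by positivity)) (fun n => ?_)
      ((hs u hu).mul_left (log 2)⁻¹)
    rw [← mul_div_assoc]
    gcongr
    rcases lt_or_ge n 2 with h | h
    · interval_cases n <;> simp [h0, h1, hg]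
    · have h2 : 0 < log 2 := log_pos (by norm_num)
      have : log 2 ≤ log n := log_le_log (by norm_num) (by exact_mod_cast h)
      rw [← hgf n, inv_mul_eq_div, le_div_iff₀ h2]
      exact mul_le_mul_of_nonneg_left this (hg0 n)
  set G := ∑' n : ℕ, g n / (n : ℝ) ^ (2 : ℝ) with hG
  have hG0 : 0 ≤ G := tsum_nonneg fun n => div_nonneg (hg0 n) (by positivity)
  have main : ∀ X : ℝ, 3 ≤ X →
      |∑ n ∈ Finset.range (⌊X⌋₊ + 1), f n / (n * log n) - A * log (log X)| ≤
        C + G + 3 * (A + C) ∧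
      ∑ n ∈ Finset.range (⌊X⌋₊ + 1), f n / n ≤ (3 * (A + C)) * log X := by
    intro X hX
    have hX0 : 0 < X := by linarith
    have he : exp 1 < 3 := exp_one_lt_three
    have hL : 1 < log X := by
      rw [lt_log_iff_exp_lt hX0]; linarith
    set L := log X with hLdef
    have hL0 : 0 < L := by linarith
    set σ := L⁻¹ with hσ
    have hσ0 : 0 < σ := by positivity
    have hσ1 : σ < 1 := inv_lt_one_of_one_lt₀ hL
    have hσL : σ * L = 1 := inv_mul_cancel₀ hL0.ne'
    have hp1 : 1 < 1 + σ := by linarith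
    set F := ∑' n : ℕ, f n / (n : ℝ) ^ (1 + σ) with hF
    have hFle : F ≤ A * L + C := by
      have := (abs_le.1 (hC (1 + σ) ⟨hp1, by linarith⟩)).2
      rw [add_sub_cancel_left, hσ, div_inv_eq_mul] at this
      linarith
    have hσF : σ * F ≤ A + C := by
      calc σ * F ≤ σ * (A * L + C) := by gcongr
        _ = A * (σ * L) + σ * C := by ring
        _ ≤ A + C := by rw [hσL]; nlinarith
    have hrp : ∀ n : ℕ, 0 < n → ((n : ℝ) ^ (1 + σ))⁻¹ = (n : ℝ)⁻¹ * exp (-(σ * log n)) := by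
      intro n hn
      have hn' : (0 : ℝ) < n := by exact_mod_cast hn
      rw [rpow_add hn', rpow_one, mul_inv, exp_neg, rpow_def_of_pos hn', mul_comm σ]
    have hlogle : ∀ n ∈ Finset.range (⌊X⌋₊ + 1), 0 < n → log n ≤ L := by
      intro n hn hn0
      have h3 : (n : ℝ) ≤ X := (Nat.le_floor_iff hX0.le).1 (Nat.lt_succ_iff.1 (Finset.mem_range.1 hn))
      exact log_le_log (by exact_mod_cast hn0) h3
    have hsumle : ∑ n ∈ Finset.range (⌊X⌋₊ + 1), f n / n ≤ 3 * F := by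
      calc _ ≤ ∑ n ∈ Finset.range (⌊X⌋₊ + 1), 3 * (f n / (n : ℝ) ^ (1 + σ)) := by
            refine Finset.sum_le_sum fun n hn => ?_
            rcases n.eq_zero_or_pos with rfl | hn0
            · simp [h0]
            · rw [div_eq_mul_inv, div_eq_mul_inv, hrp n hn0]
              have h2 : exp (-1) ≤ exp (-(σ * log n)) := by
                apply exp_le_exp.2
                have := mul_le_mul_of_nonneg_left (hlogle n hn hn0) hσ0.le
                linarith
              have h3 : 1 ≤ 3 * exp (-1) := by
                rw [exp_neg, ← div_eq_mul_inv, le_div_iff₀ (exp_pos _)]; linarith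
              have h4 : 0 ≤ f n * (n : ℝ)⁻¹ := mul_nonneg (hf n) (by positivity)
              nlinarith
        _ = 3 * ∑ n ∈ Finset.range (⌊X⌋₊ + 1), f n / (n : ℝ) ^ (1 + σ) := by
            rw [Finset.mul_sum]
        _ ≤ 3 * F := by
            gcongr
            exact (hs _ hp1).sum_le_tsum _ fun n _ => div_nonneg (hf n) (by positivity)
    have hM : ∑ n ∈ Finset.range (⌊X⌋₊ + 1), f n / (n * log n) =
        ∑ n ∈ Finset.range (⌊X⌋₊ + 1), g n / n := by
      refine Finset.sum_congr rfl fun n _ => ?_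
      simp only [hg]; rw [div_div, mul_comm (log _)]
    set P := ∑' n : ℕ, g n / (n : ℝ) ^ (1 + σ) with hP
    have hup : ∑ n ∈ Finset.range (⌊X⌋₊ + 1), g n / n ≤ P + σ * (3 * F) := by
      calc _ ≤ ∑ n ∈ Finset.range (⌊X⌋₊ + 1), (g n / (n : ℝ) ^ (1 + σ) + σ * (f n / n)) := by
            refine Finset.sum_le_sum fun n hn => ?_
            rcases n.eq_zero_or_pos with rfl | hn0
            · simp [h0, hg]
            · rw [div_eq_mul_inv, div_eq_mul_inv, div_eq_mul_inv, hrp n hn0]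
              have h2 := add_one_le_exp (-(σ * log n))
              have h4 : 0 ≤ g n * (n : ℝ)⁻¹ := mul_nonneg (hg0 n) (by positivity)
              rw [← hgf n]
              nlinarith
        _ = ∑ n ∈ Finset.range (⌊X⌋₊ + 1), g n / (n : ℝ) ^ (1 + σ) +
            σ * ∑ n ∈ Finset.range (⌊X⌋₊ + 1), f n / n := by
            rw [Finset.mul_sum, Finset.sum_add_distrib]
        _ ≤ _ := by
            gcongr
            exact (hgs _ hp1).sum_le_tsum _ fun n _ => div_nonneg (hg0 n) (by positivity)
    have hlow : P ≤ ∑ n ∈ Finset.range (⌊X⌋₊ + 1), g n / n + σ * F := by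
      have hfin : HasSum (fun n => if n ∈ Finset.range (⌊X⌋₊ + 1) then g n / n else 0)
          (∑ n ∈ Finset.range (⌊X⌋₊ + 1), g n / n) := by
        rw [← Finset.sum_congr rfl fun n (hn : n ∈ Finset.range (⌊X⌋₊ + 1)) =>
          if_pos (c := n ∈ Finset.range (⌊X⌋₊ + 1)) (t := g n / n) (e := 0) hn]
        exact hasSum_sum_of_ne_finset_zero fun n hn => if_neg hn
      refine hasSum_le (fun n => ?_) (hgs _ hp1).hasSum (hfin.add ((hs _ hp1).hasSum.mul_left σ))
      rcases n.eq_zero_or_pos with rfl | hn0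
      · simp [h0, hg]
      · split_ifs with hn
        · rw [div_eq_mul_inv, div_eq_mul_inv, div_eq_mul_inv, hrp n hn0]
          have h2 : exp (-(σ * log n)) ≤ 1 := exp_le_one_iff.2 (by
            have := mul_nonneg hσ0.le (hlog n); linarith)
          have h4 : 0 ≤ g n * (n : ℝ)⁻¹ := mul_nonneg (hg0 n) (by positivity)
          have h5 : 0 ≤ σ * (f n * ((n : ℝ)⁻¹ * exp (-(σ * log n)))) := by
            have := hf n; positivity
          nlinarith
        · rw [zero_add, ← mul_div_assoc]
          gcongr
          rw [← hgf n]
          have h3 : L ≤ log n := by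
            apply log_le_log hX0
            rw [Finset.mem_range, not_lt, Nat.succ_le_iff, Nat.floor_lt hX0.le] at hn
            exact hn.le
          have h4 : 1 ≤ σ * log n := by rw [← hσL]; gcongr
          nlinarith [hg0 n]
    obtain ⟨hI, hcs⟩ := hasSum_integral_dirichlet hf (p := 1 + σ) (q := 2) (by linarith)
      (hs _ hp1) h0
    have hPI : (∫ u in (1 + σ)..2, ∑' n : ℕ, f n / (n : ℝ) ^ u) = P - G := by
      refine hI.unique ?_
      convert! (hgs _ hp1).hasSum.sub (hgs 2 (by norm_num)).hasSum using 2 with n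
      rcases lt_or_ge n 2 with h | h
      · interval_cases n <;> simp [h0, h1, hg]
      · simp only [div_eq_mul_inv, intervalIntegral.integral_const_mul]
        rw [integral_rpow_neg_exponent (by exact_mod_cast h)]
        simp only [hg]; ring
    have hIA : (∫ u in (1 + σ)..2, A / (u - 1)) = A * log L := by
      have hder : ∀ u ∈ Set.uIcc (1 + σ) 2, HasDerivAt (fun u => A * log (u - 1)) (A / (u - 1)) u := by
        intro u hu
        rw [Set.uIcc_of_le (by linarith)] at hu
        have hu1 : u - 1 ≠ 0 := by linarith [hu.1]
        convert! (((hasDerivAt_id u).sub_const 1).log hu1).const_mul A using 1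
        simp [div_eq_mul_inv]
      rw [intervalIntegral.integral_eq_sub_of_hasDerivAt hder]
      · norm_num [hσ]
      · apply ContinuousOn.intervalIntegrable
        rw [Set.uIcc_of_le (by linarith)]
        refine continuousOn_const.div (by fun_prop) fun u hu => by linarith [hu.1]
    have hdiff : |(P - G) - A * log L| ≤ C := by
      rw [← hPI, ← hIA, ← intervalIntegral.integral_sub]
      · have := intervalIntegral.norm_integral_le_of_norm_le_const (a := 1 + σ) (b := 2) (C := C)
          (f := fun u => ∑' n : ℕ, f n / (n : ℝ) ^ u - A / (u - 1)) (fun u hu => by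
            rw [Set.uIoc_of_le (by linarith)] at hu
            exact hC u ⟨by linarith [hu.1], hu.2⟩)
        refine this.trans ?_
        rw [abs_of_nonneg (by linarith)]
        nlinarith
      · apply ContinuousOn.intervalIntegrable
        rwa [Set.uIcc_of_le (by linarith)]
      · apply ContinuousOn.intervalIntegrable
        rw [Set.uIcc_of_le (by linarith)]
        refine continuousOn_const.div (by fun_prop) fun u hu => by linarith [hu.1]
    obtain ⟨hd1, hd2⟩ := abs_le.1 hdiff
    rw [hM]
    refine ⟨abs_le.2 ⟨?_, ?_⟩, hsumle.trans ?_⟩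
    · linarith
    · linarith
    · nlinarith
  exact ⟨⟨_, fun X hX => (main X hX).1⟩, ⟨_, fun X hX => (main X hX).2⟩⟩

/-- Prime powers `q ≤ Y` with `q ≡ 1 (mod 4)`. -/
noncomputable def primePowersOneModFour (Y : ℝ) : Finset ℕ :=
  {q ∈ Finset.Ioc 0 ⌊Y⌋₊ | IsPrimePow q ∧ q % 4 = 1}

lemma sum_log_isPrimePow_le : ∃ C : ℝ, ∀ Y : ℝ, 0 ≤ Y →
    ∑ q ∈ Finset.Ioc 0 ⌊Y⌋₊ with IsPrimePow q, log q ≤ C * Y := by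
  obtain ⟨C, hC⟩ := Chebyshev.psi_sub_theta_le_mul_sqrt
  have hl2 : 0 < log 2 := log_pos (by norm_num)
  refine ⟨log 4 + 4 + 2 / log 2 * C, fun Y hY => ?_⟩
  rcases lt_or_ge Y 1 with h | h
  · have hC0 : 0 ≤ C := by
      have h1 := hC 1
      simpa using h1
    have : 0 ≤ log 4 := log_nonneg (by norm_num)
    rw [Nat.floor_eq_zero.2 h]
    simp
    positivity
  have hlY : log Y ≤ 2 * √Y := by
    have := log_le_self (sqrt_nonneg Y)
    rw [log_sqrt hY] at this
    linarith
  have hlY0 : 0 ≤ log Y := log_nonneg h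
  have hsq : √Y * √Y = Y := mul_self_sqrt hY
  calc _ ≤ ∑ q ∈ Finset.Ioc 0 ⌊Y⌋₊, (ArithmeticFunction.vonMangoldt q + log Y / log 2 *
        (if q.Prime then 0 else ArithmeticFunction.vonMangoldt q)) := by
        rw [Finset.sum_filter]
        refine Finset.sum_le_sum fun q hq => ?_
        obtain ⟨hq0, hqY⟩ := Finset.mem_Ioc.1 hq
        have hΛ : 0 ≤ ArithmeticFunction.vonMangoldt q := ArithmeticFunction.vonMangoldt_nonneg
        split_ifs with h1 h2 h2
        · rw [ArithmeticFunction.vonMangoldt_apply_prime h2]; simp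
        · obtain ⟨p, k, hp, hk, rfl⟩ := (isPrimePow_nat_iff q).1 h1
          rw [ArithmeticFunction.vonMangoldt_apply_pow hk.ne',
            ArithmeticFunction.vonMangoldt_apply_prime hp] at *
          have h3 : (p : ℝ) ^ k ≤ Y := by
            have := (Nat.le_floor_iff hY).1 hqY
            exact_mod_cast this
          have hp2 : log 2 ≤ log p := log_le_log (by norm_num) (by exact_mod_cast hp.two_le)
          have h4 : (k : ℝ) ≤ log Y / log 2 := by
            rw [le_div_iff₀ hl2]
            have := log_le_log (by have := hp.pos; positivity) h3
            rw [log_pow] at this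
            nlinarith
          push_cast
          rw [log_pow]
          nlinarith
        · positivity
        · positivity
    _ = Chebyshev.psi Y + log Y / log 2 * (Chebyshev.psi Y - Chebyshev.theta Y) := by
        rw [Finset.sum_add_distrib, ← Finset.mul_sum, Chebyshev.psi_sub_theta_eq_sum_not_prime,
          Finset.sum_filter, Chebyshev.psi]
        congr 2
        exact Finset.sum_congr rfl fun q _ => by split_ifs <;> simp_all
    _ ≤ (log 4 + 4) * Y + 2 * √Y / log 2 * (C * √Y) := by
        have h1 := Chebyshev.psi_le_const_mul_self hY
        have h2 := hC Y
        have h3 := Chebyshev.theta_le_psi Y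
        have h4 : 0 ≤ Chebyshev.psi Y - Chebyshev.theta Y := by linarith
        gcongr
    _ = _ := by
        linear_combination 2 * C / log 2 * hsq

open ArithmeticFunction.vonMangoldt in
lemma exists_sum_inv_oneModFour_bounds : ∃ D : ℝ, 0 < D ∧ ∀ X : ℝ, 3 ≤ X →
    2⁻¹ * log (log X) - D ≤ ∑ p ∈ primesOneModFour 0 X, (p : ℝ)⁻¹ ∧
    ∑ q ∈ primePowersOneModFour X, (q : ℝ)⁻¹ ≤ 2⁻¹ * log (log X) + D ∧
    ∑ p ∈ primesOneModFour 0 X, log p / p ≤ D * log X := by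
  obtain ⟨C, hC⟩ := exists_abs_tsum_residueClass_sub_le (a := (1 : ZMod 4)) isUnit_one
  have htot : ((Nat.totient 4 : ℕ) : ℝ)⁻¹ = 2⁻¹ := by
    have : Nat.totient 4 = 2 := by decide
    rw [this]; norm_num
  rw [htot] at hC
  have hres := residueClass_one_four_apply
  have hnn := residueClass_nonneg (1 : ZMod 4)
  obtain ⟨⟨D1, hD1⟩, ⟨D2, hD2⟩⟩ := exists_abs_sum_div_log_sub_le (residueClass_nonneg (1 : ZMod 4))
    (by simp) (by simp)
    (fun u hu => summable_residueClass_div_rpow _ hu) (by norm_num) hC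
  have hsum := summable_residueClass_non_primes_div (1 : ZMod 4)
  set E := ∑' n : ℕ, (if n.Prime then 0 else residueClass (1 : ZMod 4) n) / n with hE
  have hterm0 : ∀ n : ℕ, 0 ≤ (if n.Prime then 0 else residueClass (1 : ZMod 4) n) / n := by
    intro n; have := hnn n; positivity
  have hE0 : 0 ≤ E := tsum_nonneg hterm0
  have hfin : ∀ s : Finset ℕ, ∑ n ∈ s, (if n.Prime then 0 else residueClass (1 : ZMod 4) n) / n ≤ E :=
    fun s => hsum.sum_le_tsum s fun n _ => hterm0 n
  have hlog1 : ∀ n : ℕ, 3 ≤ n → 1 ≤ log n := by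
    intro n hn
    have : (3 : ℝ) ≤ n := by exact_mod_cast hn
    rw [le_log_iff_exp_le (by linarith)]
    linarith [exp_one_lt_three]
  have hrp : ∀ p : ℕ, p.Prime → p % 4 = 1 → residueClass (1 : ZMod 4) p = log p := by
    intro p hp h4
    rw [hres, if_pos h4, ArithmeticFunction.vonMangoldt_apply_prime hp]
  have hsub : ∀ X : ℝ, 0 ≤ X → primesOneModFour 0 X ⊆ Finset.range (⌊X⌋₊ + 1) := by
    intro X hX p hp
    rw [Finset.mem_range, Nat.lt_succ_iff]
    exact Nat.le_floor (mem_primesOneModFour.1 hp).2.2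
  refine ⟨|D1| + E + |D2| + 1, by positivity, fun X hX => ?_⟩
  have hL : 0 ≤ log X := log_nonneg (by linarith)
  have hM := abs_le.1 (hD1 X hX)
  have hM1 := le_abs_self D1
  refine ⟨?_, ?_, ?_⟩
  · have key : ∑ n ∈ Finset.range (⌊X⌋₊ + 1), residueClass (1 : ZMod 4) n / (n * log n) ≤
        ∑ p ∈ primesOneModFour 0 X, (p : ℝ)⁻¹ + E := by
      refine le_trans ?_ (add_le_add_right (hfin (Finset.range (⌊X⌋₊ + 1))) _)
      calc _ ≤ ∑ n ∈ Finset.range (⌊X⌋₊ + 1), ((if n ∈ primesOneModFour 0 X then (n : ℝ)⁻¹ else 0) +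
            (if n.Prime then 0 else residueClass (1 : ZMod 4) n) / n) := by
            refine Finset.sum_le_sum fun n hn => ?_
            have hnX : (n : ℝ) ≤ X := (Nat.le_floor_iff (by linarith)).1
              (Nat.lt_succ_iff.1 (Finset.mem_range.1 hn))
            by_cases hn3 : 3 ≤ n
            · by_cases hp : n.Prime
              · by_cases h4 : n % 4 = 1
                · rw [if_pos hp, if_pos (mem_primesOneModFour.2 ⟨⟨hp, h4⟩, by positivity, hnX⟩),
                    hrp n hp h4]
                  have := hlog1 n hn3
                  have h3 : (3 : ℝ) ≤ n := by exact_mod_cast hn3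
                  apply le_of_eq
                  field_simp
                  simp
                · rw [if_pos hp, hres, if_neg h4, zero_div, zero_div, add_zero]
                  positivity
              · rw [if_neg hp]
                have h1 : residueClass (1 : ZMod 4) n / (n * log n) ≤
                    residueClass (1 : ZMod 4) n / n := by
                  have h3 : (3 : ℝ) ≤ n := by exact_mod_cast hn3
                  have := hlog1 n hn3
                  have := hnn n
                  gcongr
                  nlinarith
                have h2 : (0 : ℝ) ≤ if n ∈ primesOneModFour 0 X then (n : ℝ)⁻¹ else 0 := by
                  positivity
                linarith
            · have h0 : residueClass (1 : ZMod 4) n = 0 := by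
                have : n < 3 := by lia
                interval_cases n <;> simp [hres]
              rw [h0, zero_div]
              positivity
        _ = _ := by
            rw [Finset.sum_add_distrib, ← Finset.sum_filter]
            congr 2
            rw [Finset.filter_mem_eq_inter, Finset.inter_eq_right.2 (hsub X (by linarith))]
    linarith [abs_nonneg D2, hM.1]
  · have key : ∑ q ∈ primePowersOneModFour X, (q : ℝ)⁻¹ ≤
        ∑ n ∈ Finset.range (⌊X⌋₊ + 1), residueClass (1 : ZMod 4) n / (n * log n) + E := by
      refine le_trans ?_ (add_le_add_right (hfin (Finset.range (⌊X⌋₊ + 1))) _)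
      rw [← Finset.sum_add_distrib]
      refine (Finset.sum_le_sum fun q hq => ?_).trans
        (Finset.sum_le_sum_of_subset_of_nonneg (s := primePowersOneModFour X) (fun q hq => ?_)
          fun n _ _ => add_nonneg (div_nonneg (hnn n)
            (mul_nonneg (by positivity) (log_natCast_nonneg n))) (hterm0 n))
      · obtain ⟨hq1, hpp, h4⟩ := Finset.mem_filter.1 hq
        have hq3 : 3 ≤ q := by have := hpp.two_le; lia
        have h3 : (3 : ℝ) ≤ q := by exact_mod_cast hq3
        have hl := hlog1 q hq3
        by_cases hp : q.Prime
        · rw [if_pos hp, hrp q hp h4, zero_div, add_zero]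
          apply le_of_eq
          field_simp
        · rw [if_neg hp]
          have h5 : 1 ≤ residueClass (1 : ZMod 4) q := by
            rw [hres, if_pos h4]
            obtain ⟨p, k, hp', hk, rfl⟩ := (isPrimePow_nat_iff q).1 hpp
            rw [ArithmeticFunction.vonMangoldt_apply_pow hk.ne',
              ArithmeticFunction.vonMangoldt_apply_prime hp']
            apply hlog1
            have := hp'.two_le
            by_contra hlt
            have : p = 2 := by lia
            subst this
            have h6 : 2 ∣ 2 ^ k := dvd_pow_self 2 hk.ne'
            lia
          have h6 : 0 ≤ residueClass (1 : ZMod 4) q / (q * log q) := by positivity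
          have h7 : (q : ℝ)⁻¹ ≤ residueClass (1 : ZMod 4) q / q := by
            rw [← one_div]; gcongr
          linarith
      · have := (Finset.mem_Ioc.1 (Finset.mem_filter.1 hq).1).2
        exact Finset.mem_range.2 (by lia)
    linarith [abs_nonneg D2, hM.2]
  · calc ∑ p ∈ primesOneModFour 0 X, log p / p
        = ∑ p ∈ primesOneModFour 0 X, residueClass (1 : ZMod 4) p / p := by
          refine Finset.sum_congr rfl fun p hp => ?_
          obtain ⟨⟨h1, h2⟩, _⟩ := mem_primesOneModFour.1 hp
          rw [hrp p h1 h2]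
      _ ≤ ∑ n ∈ Finset.range (⌊X⌋₊ + 1), residueClass (1 : ZMod 4) n / n :=
          Finset.sum_le_sum_of_subset_of_nonneg (hsub X (by linarith))
            fun n _ _ => div_nonneg (hnn n) (by positivity)
      _ ≤ D2 * log X := hD2 X hX
      _ ≤ _ := by
          have := le_abs_self D2
          have := abs_nonneg D1
          gcongr
          linarith

open Classical in
/-- The elements of `A1` up to `X` with exactly `k` distinct prime divisors. -/
noncomputable def boundedA1 (k : ℕ) (X : ℝ) : Finset ℕ :=
  {m ∈ Finset.Ioc 0 ⌊X⌋₊ | m ∈ A1 ∧ m.primeFactors.card = k}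

lemma mem_boundedA1 {k : ℕ} {X : ℝ} {m : ℕ} :
    m ∈ boundedA1 k X ↔ (m : ℝ) ≤ X ∧ m ∈ A1 ∧ m.primeFactors.card = k := by
  simp only [boundedA1, Finset.mem_filter, Finset.mem_Ioc]
  constructor
  · rintro ⟨⟨h0, h⟩, h'⟩
    exact ⟨(Nat.le_floor_iff' h0.ne').1 h, h'⟩
  · rintro ⟨h, h'⟩
    exact ⟨⟨h'.1.1, Nat.le_floor h⟩, h'⟩

lemma primeFactors_ordCompl_eq_erase (m p : ℕ) :
    (ordCompl[p] m).primeFactors = m.primeFactors.erase p := by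
  rw [← Nat.support_factorization, Nat.factorization_ordCompl, Finsupp.support_erase,
    Nat.support_factorization]

lemma ordCompl_mem_boundedA1 {k m p : ℕ} {X : ℝ} (hm : m ∈ boundedA1 (k + 1) X)
    (hp : p ∈ m.primeFactors) : ordCompl[p] m ∈ boundedA1 k X := by
  obtain ⟨hX, ⟨h0, hA⟩, hk⟩ := mem_boundedA1.1 hm
  have hd : ordCompl[p] m ∣ m := Nat.ordCompl_dvd m p
  refine mem_boundedA1.2 ⟨?_, ⟨Nat.ordCompl_pos p h0.ne', fun r hr hrd => hA r hr (hrd.trans hd)⟩, ?_⟩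
  · exact le_trans (by exact_mod_cast Nat.le_of_dvd h0 hd) hX
  · rw [primeFactors_ordCompl_eq_erase, Finset.card_erase_of_mem hp, hk, Nat.add_sub_cancel]

lemma ordProj_mem_primePowersOneModFour {k m p : ℕ} {X : ℝ} (hm : m ∈ boundedA1 k X)
    (hp : p ∈ m.primeFactors) :
    ordProj[p] m ∈ primePowersOneModFour (X / (ordCompl[p] m : ℕ)) := by
  obtain ⟨hX, ⟨h0, hA⟩, -⟩ := mem_boundedA1.1 hm
  obtain ⟨hpp, hpd, -⟩ := Nat.mem_primeFactors.1 hp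
  have hv : m.factorization p ≠ 0 := (hpp.factorization_pos_of_dvd h0.ne' hpd).ne'
  refine Finset.mem_filter.2 ⟨Finset.mem_Ioc.2 ⟨Nat.ordProj_pos m p, Nat.le_floor ?_⟩,
    hpp.isPrimePow.pow hv, ?_⟩
  · have hc : (0 : ℝ) < (ordCompl[p] m : ℕ) := by exact_mod_cast Nat.ordCompl_pos p h0.ne'
    rw [le_div_iff₀ hc]
    exact le_trans (le_of_eq (by exact_mod_cast Nat.ordProj_mul_ordCompl_eq_self m p)) hX
  · simp [Nat.pow_mod, hA p hpp hpd]

lemma sum_ordProj_ordCompl_le {φ ψ : ℕ → ℝ} (hφ : ∀ n, 0 ≤ φ n) (hψ : ∀ n, 0 ≤ ψ n) (k : ℕ)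
    (X : ℝ) :
    ∑ m ∈ boundedA1 (k + 1) X, ∑ p ∈ m.primeFactors, φ (ordProj[p] m) * ψ (ordCompl[p] m) ≤
      ∑ m ∈ boundedA1 k X, ψ m * ∑ q ∈ primePowersOneModFour (X / m), φ q := by
  simp_rw [Finset.mul_sum]
  rw [Finset.sum_sigma', Finset.sum_sigma']
  set S := (boundedA1 (k + 1) X).sigma fun m => m.primeFactors with hS
  set i : (Σ _ : ℕ, ℕ) → (Σ _ : ℕ, ℕ) := fun x => ⟨ordCompl[x.2] x.1, ordProj[x.2] x.1⟩ with hi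
  have hinj : Set.InjOn i S := by
    rintro ⟨m, p⟩ hx ⟨m', p'⟩ hx' h
    obtain ⟨hm, hp⟩ := Finset.mem_sigma.1 hx
    obtain ⟨hm', hp'⟩ := Finset.mem_sigma.1 hx'
    simp only [hi, Sigma.mk.injEq, heq_eq_eq] at h hm hp hm' hp'
    obtain ⟨hpp, hpd, h0⟩ := Nat.mem_primeFactors.1 hp
    obtain ⟨hpp', hpd', h0'⟩ := Nat.mem_primeFactors.1 hp'
    have e1 := Nat.ordProj_mul_ordCompl_eq_self m p
    have e2 := Nat.ordProj_mul_ordCompl_eq_self m' p'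
    rw [h.1, h.2, e2] at e1
    have e3 := congrArg Nat.minFac h.2
    rw [hpp.pow_minFac (hpp.factorization_pos_of_dvd h0 hpd).ne',
      hpp'.pow_minFac (hpp'.factorization_pos_of_dvd h0' hpd').ne'] at e3
    simp [e1, e3]
  calc _ = ∑ x ∈ S.image i, ψ x.1 * φ x.2 := by
        rw [Finset.sum_image hinj]
        exact Finset.sum_congr rfl fun x _ => mul_comm _ _
    _ ≤ _ := by
        refine Finset.sum_le_sum_of_subset_of_nonneg ?_ fun x _ _ => mul_nonneg (hψ _) (hφ _)
        intro y hy
        obtain ⟨⟨m, p⟩, hx, rfl⟩ := Finset.mem_image.1 hy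
        obtain ⟨hm, hp⟩ := Finset.mem_sigma.1 hx
        exact Finset.mem_sigma.2
          ⟨ordCompl_mem_boundedA1 hm hp, ordProj_mem_primePowersOneModFour hm hp⟩

lemma primePowersOneModFour_mono {X Y : ℝ} (h : X ≤ Y) :
    primePowersOneModFour X ⊆ primePowersOneModFour Y :=
  Finset.filter_subset_filter _ (Finset.Ioc_subset_Ioc_right (Nat.floor_le_floor h))

lemma sum_inv_boundedA1_le (k : ℕ) {X : ℝ} (hX : 0 ≤ X) :
    ∑ m ∈ boundedA1 k X, (m : ℝ)⁻¹ ≤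
      (∑ q ∈ primePowersOneModFour X, (q : ℝ)⁻¹) ^ k / (k.factorial : ℝ) := by
  set Q := ∑ q ∈ primePowersOneModFour X, (q : ℝ)⁻¹ with hQ
  have hQ0 : 0 ≤ Q := Finset.sum_nonneg fun _ _ => by positivity
  induction k with
  | zero =>
    have : boundedA1 0 X ⊆ {1} := by
      intro m hm
      obtain ⟨-, ⟨h0, -⟩, h⟩ := mem_boundedA1.1 hm
      rw [Finset.card_eq_zero, Nat.primeFactors_eq_empty] at h
      simp; lia
    refine (Finset.sum_le_sum_of_subset_of_nonneg this fun _ _ _ => by positivity).trans ?_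
    simp
  | succ k ih =>
    have h1 := sum_ordProj_ordCompl_le (φ := fun n => (n : ℝ)⁻¹) (ψ := fun n => (n : ℝ)⁻¹)
      (fun n => by positivity) (fun n => by positivity) k X
    have h2 : ∑ m ∈ boundedA1 (k + 1) X, ∑ p ∈ m.primeFactors,
        ((ordProj[p] m : ℕ) : ℝ)⁻¹ * ((ordCompl[p] m : ℕ) : ℝ)⁻¹ =
        (k + 1) * ∑ m ∈ boundedA1 (k + 1) X, (m : ℝ)⁻¹ := by
      rw [Finset.mul_sum]
      refine Finset.sum_congr rfl fun m hm => ?_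
      rw [Finset.sum_congr rfl (g := fun _ => (m : ℝ)⁻¹), Finset.sum_const,
        (mem_boundedA1.1 hm).2.2, nsmul_eq_mul]
      · push_cast; ring
      · intro p _
        rw [← mul_inv, ← Nat.cast_mul, Nat.ordProj_mul_ordCompl_eq_self]
    have h3 : ∑ m ∈ boundedA1 k X, (m : ℝ)⁻¹ * ∑ q ∈ primePowersOneModFour (X / m), (q : ℝ)⁻¹ ≤
        Q * ∑ m ∈ boundedA1 k X, (m : ℝ)⁻¹ := by
      rw [Finset.mul_sum]
      refine Finset.sum_le_sum fun m hm => ?_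
      rw [mul_comm]
      have hm1 : (1 : ℝ) ≤ m := by exact_mod_cast (mem_boundedA1.1 hm).2.1.1
      gcongr
      refine Finset.sum_le_sum_of_subset_of_nonneg
        (primePowersOneModFour_mono (div_le_self hX hm1)) fun _ _ _ => by positivity
    rw [h2] at h1
    have h4 := h1.trans (h3.trans (mul_le_mul_of_nonneg_left ih hQ0))
    rw [Nat.factorial_succ, le_div_iff₀ (by positivity)]
    rw [← mul_div_assoc, le_div_iff₀ (by positivity)] at h4
    push_cast
    calc _ = (k + 1) * (∑ m ∈ boundedA1 (k + 1) X, (m : ℝ)⁻¹) * k.factorial := by ring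
      _ ≤ _ := h4
      _ = _ := by ring

lemma sum_log_boundedA1_le : ∃ C : ℝ, 0 < C ∧ ∀ (k : ℕ) (X : ℝ), 0 ≤ X →
    ∑ m ∈ boundedA1 (k + 1) X, log m ≤
      C * X * ((∑ q ∈ primePowersOneModFour X, (q : ℝ)⁻¹) ^ k / (k.factorial : ℝ)) := by
  obtain ⟨C, hC⟩ := sum_log_isPrimePow_le
  refine ⟨|C| + 1, by positivity, fun k X hX => ?_⟩
  have h1 := sum_ordProj_ordCompl_le (φ := fun n => log n) (ψ := fun _ => 1)
      (fun n => log_natCast_nonneg n) (fun n => by positivity) k X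
  have h2 : ∑ m ∈ boundedA1 (k + 1) X, log m = ∑ m ∈ boundedA1 (k + 1) X, ∑ p ∈ m.primeFactors,
      log (ordProj[p] m : ℕ) * 1 := by
    refine Finset.sum_congr rfl fun m hm => ?_
    have hm0 := (mem_boundedA1.1 hm).2.1.1
    simp_rw [mul_one]
    rw [← log_prod (fun p _ => by exact_mod_cast (Nat.ordProj_pos m p).ne')]
    congr 1
    rw [← Nat.cast_prod]
    congr 1
    conv_lhs => rw [← Nat.prod_factorization_pow_eq_self hm0.ne']
    rw [Nat.prod_factorization_eq_prod_primeFactors]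
  rw [h2]
  refine h1.trans ?_
  calc _ ≤ ∑ m ∈ boundedA1 k X, (|C| + 1) * X * (m : ℝ)⁻¹ := by
        refine Finset.sum_le_sum fun m hm => ?_
        rw [one_mul]
        have hXm : 0 ≤ X / m := by positivity
        calc _ ≤ ∑ q ∈ Finset.Ioc 0 ⌊X / m⌋₊ with IsPrimePow q, log q := by
              refine Finset.sum_le_sum_of_subset_of_nonneg (fun q hq => ?_)
                fun q _ _ => log_natCast_nonneg q
              obtain ⟨h1, h2, -⟩ := Finset.mem_filter.1 hq
              exact Finset.mem_filter.2 ⟨h1, h2⟩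
          _ ≤ C * (X / m) := hC _ hXm
          _ ≤ (|C| + 1) * (X / m) := by
              gcongr
              linarith [le_abs_self C]
          _ = _ := by ring
    _ = (|C| + 1) * X * ∑ m ∈ boundedA1 k X, (m : ℝ)⁻¹ := by rw [Finset.mul_sum]
    _ ≤ _ := by
        gcongr
        exact sum_inv_boundedA1_le k hX

lemma add_pow_le_pow_mul_exp {y d c : ℝ} {k : ℕ} (hy : 0 < y) (hd : 0 ≤ d) (hk : (k : ℝ) ≤ c * y) :
    (y + d) ^ k ≤ exp (c * d) * y ^ k := by
  have h1 : y + d = y * (1 + d / y) := by field_simp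
  rw [h1, mul_pow, mul_comm]
  gcongr
  calc (1 + d / y) ^ k ≤ exp (d / y) ^ k := by
        gcongr
        rw [add_comm]
        exact add_one_le_exp _
    _ = exp (k * (d / y)) := (exp_nat_mul _ _).symm
    _ ≤ exp (c * d) := by
        apply exp_le_exp.2
        calc k * (d / y) ≤ (c * y) * (d / y) := by gcongr
          _ = c * d := by field_simp

lemma tendsto_log_log : Filter.Tendsto (fun x : ℝ => log (log x)) Filter.atTop Filter.atTop :=
  tendsto_log_atTop.comp tendsto_log_atTop

/-- The elements of `A1` in `[Y, X]` with exactly `k` distinct prime divisors. -/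
noncomputable def windowA1 (k : ℕ) (Y X : ℝ) : Finset ℕ :=
  {m ∈ boundedA1 k X | Y ≤ m}

lemma mem_windowA1 {k : ℕ} {Y X : ℝ} {m : ℕ} : m ∈ windowA1 k Y X ↔
    Y ≤ m ∧ (m : ℝ) ≤ X ∧ m ∈ A1 ∧ m.primeFactors.card = k := by
  rw [windowA1, Finset.mem_filter, mem_boundedA1, and_comm]

lemma exists_card_windowA1_le {a b c : ℝ} (ha : 0 < a) (hb : 0 < b) :
    ∃ C : ℝ, 0 < C ∧ ∀ᶠ x : ℝ in Filter.atTop, ∀ k : ℕ, (k + 1 : ℝ) ≤ c * log (log x) →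
      ((windowA1 (k + 1) (a * x ^ 2) (b * x ^ 2)).card : ℝ) ≤
        C * (x ^ 2 / log x) * ((2⁻¹ * log (log x)) ^ k / (k.factorial : ℝ)) := by
  obtain ⟨C, hC0, hC⟩ := sum_log_boundedA1_le
  obtain ⟨D, hD0, hD⟩ := exists_sum_inv_oneModFour_bounds
  set d := 2⁻¹ * log 3 + D with hd
  have hd0 : 0 < d := by
    have : 0 < log 3 := log_pos (by norm_num)
    positivity
  refine ⟨C * b * exp (2 * c * d), by positivity, ?_⟩
  filter_upwards [tendsto_log_log.eventually_gt_atTop 0, Filter.eventually_gt_atTop 1,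
    Filter.eventually_ge_atTop b, Filter.eventually_ge_atTop a⁻¹,
    Filter.eventually_ge_atTop (3 / b)] with x hll hx1 hxb hxa hx3 k hk
  have hx0 : 0 < x := by linarith
  have hlx : 0 < log x := log_pos hx1
  set X := b * x ^ 2 with hX
  have hX3 : 3 ≤ X := by
    rw [div_le_iff₀ hb] at hx3
    nlinarith
  have hXle : log X ≤ 3 * log x := by
    calc log X ≤ log (x ^ 3) := by
          apply log_le_log (by positivity)
          rw [hX]
          nlinarith [sq_nonneg x]
      _ = 3 * log x := by rw [log_pow]; norm_num
  have hX1 : 1 < X := by linarith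
  have hQ : ∑ q ∈ primePowersOneModFour X, (q : ℝ)⁻¹ ≤ 2⁻¹ * log (log x) + d := by
    refine (hD X hX3).2.1.trans ?_
    have : log (log X) ≤ log 3 + log (log x) := by
      rw [← log_mul (by norm_num) hlx.ne']
      exact log_le_log (log_pos hX1) hXle
    linarith
  have hQ0 : 0 ≤ ∑ q ∈ primePowersOneModFour X, (q : ℝ)⁻¹ := Finset.sum_nonneg fun _ _ => by positivity
  have h1 := hC k X (by linarith)
  set S := windowA1 (k + 1) (a * x ^ 2) X with hS
  have h2 : S.card * log x ≤ ∑ m ∈ boundedA1 (k + 1) X, log m := by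
    rw [← nsmul_eq_mul, ← Finset.sum_const]
    refine (Finset.sum_le_sum fun m hm => ?_).trans
      (Finset.sum_le_sum_of_subset_of_nonneg (Finset.filter_subset _ _)
        fun m _ _ => log_natCast_nonneg m)
    have := (mem_windowA1.1 hm).1
    apply log_le_log hx0
    rw [inv_le_iff_one_le_mul₀ ha] at hxa
    nlinarith
  have h3 : (∑ q ∈ primePowersOneModFour X, (q : ℝ)⁻¹) ^ k ≤
      exp (2 * c * d) * (2⁻¹ * log (log x)) ^ k := by
    refine (pow_le_pow_left₀ hQ0 hQ k).trans (add_pow_le_pow_mul_exp (by positivity) hd0.le ?_)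
    linarith
  rw [show C * b * exp (2 * c * d) * (x ^ 2 / log x) *
      ((2⁻¹ * log (log x)) ^ k / (k.factorial : ℝ)) =
      C * X * (exp (2 * c * d) * (2⁻¹ * log (log x)) ^ k / k.factorial) / log x by rw [hX]; ring,
    le_div_iff₀ hlx]
  refine (h2.trans h1).trans ?_
  gcongr

/-- The `k`-th elementary symmetric sum of `w` over `P`. -/
def esymmSum (w : ℕ → ℝ) (P : Finset ℕ) (k : ℕ) : ℝ := ∑ s ∈ P.powersetCard k, ∏ p ∈ s, w p

lemma esymmSum_nonneg {w : ℕ → ℝ} (hw : ∀ n, 0 ≤ w n) (P : Finset ℕ) (k : ℕ) :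
    0 ≤ esymmSum w P k :=
  Finset.sum_nonneg fun _ _ => Finset.prod_nonneg fun n _ => hw n

lemma esymmSum_zero (w : ℕ → ℝ) (P : Finset ℕ) : esymmSum w P 0 = 1 := by
  simp [esymmSum]

lemma esymmSum_empty_succ (w : ℕ → ℝ) (k : ℕ) : esymmSum w ∅ (k + 1) = 0 := by
  rw [esymmSum, Finset.powersetCard_eq_empty.2 (by simp), Finset.sum_empty]

lemma esymmSum_one (w : ℕ → ℝ) (P : Finset ℕ) : esymmSum w P 1 = ∑ p ∈ P, w p := by
  simp [esymmSum, Finset.powersetCard_one]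

lemma esymmSum_insert_succ (w : ℕ → ℝ) {P : Finset ℕ} {r : ℕ} (hr : r ∉ P) (k : ℕ) :
    esymmSum w (insert r P) (k + 1) = esymmSum w P (k + 1) + w r * esymmSum w P k := by
  rw [esymmSum, Finset.powersetCard_succ_insert hr, Finset.sum_union, Finset.sum_image, esymmSum,
    esymmSum, Finset.mul_sum]
  · congr 1
    refine Finset.sum_congr rfl fun s hs => Finset.prod_insert fun h => hr ?_
    exact (Finset.mem_powersetCard.1 hs).1 h
  · intro s hs t ht h
    have h1 : r ∉ s := fun h => hr ((Finset.mem_powersetCard.1 hs).1 h)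
    have h2 : r ∉ t := fun h => hr ((Finset.mem_powersetCard.1 ht).1 h)
    rw [← Finset.erase_insert h1, ← Finset.erase_insert h2]
    exact congrArg (fun u => Finset.erase u r) h
  · rw [Finset.disjoint_left]
    intro s hs hs'
    obtain ⟨t, -, rfl⟩ := Finset.mem_image.1 hs'
    exact hr ((Finset.mem_powersetCard.1 hs).1 (Finset.mem_insert_self r t))

lemma factorial_mul_esymmSum_le {w : ℕ → ℝ} (hw : ∀ n, 0 ≤ w n) (P : Finset ℕ) (k : ℕ) :
    k.factorial * esymmSum w P k ≤ (∑ p ∈ P, w p) ^ k := by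
  induction P using Finset.induction_on generalizing k with
  | empty => cases k <;> simp [esymmSum_zero, esymmSum_empty_succ]
  | insert r P hr ih =>
    cases k with
    | zero => simp [esymmSum_zero]
    | succ k =>
      have hS : 0 ≤ ∑ p ∈ P, w p := Finset.sum_nonneg fun n _ => hw n
      rw [esymmSum_insert_succ w hr, Finset.sum_insert hr, add_comm (w r)]
      refine le_trans ?_ (pow_add_mul_le_add_pow hS (by linarith [hw r]) (k + 1))
      have h1 := ih (k + 1)
      have h2 := mul_le_mul_of_nonneg_left (ih k) (hw r)
      have h3 : (0 : ℝ) ≤ k + 1 := by positivity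
      have h4 := mul_le_mul_of_nonneg_left h2 h3
      rw [Nat.factorial_succ] at h1 ⊢
      rw [Nat.add_sub_cancel]
      push_cast at h1 ⊢
      linarith

lemma sub_le_succ_mul_esymmSum {w : ℕ → ℝ} (hw : ∀ n, 0 ≤ w n) (P : Finset ℕ) (k : ℕ) :
    (∑ p ∈ P, w p) * esymmSum w P (k + 1) - (∑ p ∈ P, w p ^ 2) * esymmSum w P k ≤
      (k + 2) * esymmSum w P (k + 2) := by
  induction P using Finset.induction_on generalizing k with
  | empty => simp [esymmSum_empty_succ]
  | insert r P hr ih =>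
    have hQ : 0 ≤ ∑ p ∈ P, w p ^ 2 := Finset.sum_nonneg fun n _ => sq_nonneg _
    rw [esymmSum_insert_succ w hr, esymmSum_insert_succ w hr, Finset.sum_insert hr,
      Finset.sum_insert hr]
    have h1 := ih k
    cases k with
    | zero =>
      have := hw r
      simp only [esymmSum_zero, esymmSum_one, zero_add] at *
      push_cast at *
      nlinarith
    | succ k =>
      rw [esymmSum_insert_succ w hr]
      have h2 := mul_le_mul_of_nonneg_left (ih k) (hw r)
      have h3 := mul_nonneg (pow_nonneg (hw r) 3) (esymmSum_nonneg hw P k)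
      push_cast at *
      nlinarith [h1, h2, h3]

lemma pow_mul_sub_le_factorial_mul_esymmSum {w : ℕ → ℝ} (hw : ∀ n, 0 ≤ w n) (P : Finset ℕ)
    (k : ℕ) :
    (∑ p ∈ P, w p) ^ k * ((∑ p ∈ P, w p) ^ 2 - k ^ 2 * ∑ p ∈ P, w p ^ 2) ≤
      k.factorial * esymmSum w P k * (∑ p ∈ P, w p) ^ 2 := by
  have hS : 0 ≤ ∑ p ∈ P, w p := Finset.sum_nonneg fun n _ => hw n
  have hQ : 0 ≤ ∑ p ∈ P, w p ^ 2 := Finset.sum_nonneg fun n _ => sq_nonneg _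
  have hrec := sub_le_succ_mul_esymmSum hw P
  have hup := factorial_mul_esymmSum_le hw P
  set S := ∑ p ∈ P, w p with hSdef
  set Q := ∑ p ∈ P, w p ^ 2 with hQdef
  induction k using Nat.strong_induction_on with
  | _ k ih =>
    match k with
    | 0 => simp [esymmSum_zero]
    | 1 =>
      rw [esymmSum_one, ← hSdef]
      simp
      nlinarith
    | k + 2 =>
      have h1 := mul_le_mul_of_nonneg_left (ih (k + 1) (by lia)) hS
      have h2 := hrec k
      have h3 := hup k
      have hf : (0 : ℝ) < (k.factorial : ℝ) := by positivity
      have h4 : (0 : ℝ) ≤ (k + 1) * k.factorial * S ^ 2 := by positivity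
      have h5 := mul_le_mul_of_nonneg_left h2 h4
      have h6 : (0 : ℝ) ≤ (k + 1) * Q * S ^ 2 := by positivity
      have h7 := mul_le_mul_of_nonneg_left h3 h6
      have h8 : 0 ≤ (k + 2) * S ^ (k + 2) * Q := by positivity
      rw [Nat.factorial_succ, Nat.factorial_succ]
      rw [Nat.factorial_succ] at h1
      push_cast at *
      ring_nf at *
      nlinarith [h1, h5, h7, h8]

lemma sum_card_primesOneModFour_le_card_windowA1 {a b x y : ℝ} (k : ℕ) {P : Finset ℕ}
    (hP : ∀ p ∈ P, (p.Prime ∧ p % 4 = 1) ∧ (p : ℝ) ≤ y) (hx : 0 < x)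
    (hay : y < a * x) :
    ∑ s ∈ P.powersetCard k with ((∏ p ∈ s, p : ℕ) : ℝ) ≤ x,
      (primesOneModFour (a * (x ^ 2 / (∏ p ∈ s, p : ℕ))) (b * (x ^ 2 / (∏ p ∈ s, p : ℕ)))).card ≤
      (windowA1 (k + 1) (a * x ^ 2) (b * x ^ 2)).card := by
  rw [← Finset.card_sigma]
  set S := {s ∈ P.powersetCard k | ((∏ p ∈ s, p : ℕ) : ℝ) ≤ x} with hS
  have hmem : ∀ s ∈ S, s ⊆ P ∧ s.card = k ∧ ((∏ p ∈ s, p : ℕ) : ℝ) ≤ x := by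
    intro s hs
    obtain ⟨h1, h2⟩ := Finset.mem_filter.1 hs
    obtain ⟨h3, h4⟩ := Finset.mem_powersetCard.1 h1
    exact ⟨h3, h4, h2⟩
  have hprod : ∀ s ∈ S, 0 < ∏ p ∈ s, p := fun s hs =>
    Finset.prod_pos fun p hp => (hP p ((hmem s hs).1 hp)).1.1.pos
  have hpf : ∀ s ∈ S, (∏ p ∈ s, p).primeFactors = s := fun s hs =>
    Nat.primeFactors_prod fun p hp => (hP p ((hmem s hs).1 hp)).1.1
  have hq : ∀ s ∈ S, ∀ q ∈ primesOneModFour (a * (x ^ 2 / (∏ p ∈ s, p : ℕ)))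
      (b * (x ^ 2 / (∏ p ∈ s, p : ℕ))), (q.Prime ∧ q % 4 = 1) ∧ y < q ∧
        a * x ^ 2 ≤ (q * ∏ p ∈ s, p : ℕ) ∧ ((q * ∏ p ∈ s, p : ℕ) : ℝ) ≤ b * x ^ 2 := by
    intro s hs q hq
    obtain ⟨h1, h2, h3⟩ := mem_primesOneModFour.1 hq
    have hpos : (0 : ℝ) < (∏ p ∈ s, p : ℕ) := by exact_mod_cast hprod s hs
    rw [mul_div_assoc', div_le_iff₀ hpos] at h2
    rw [mul_div_assoc', le_div_iff₀ hpos] at h3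
    refine ⟨h1, hay.trans_le ?_, by rw [Nat.cast_mul]; exact h2, by rw [Nat.cast_mul]; exact h3⟩
    have h4 := (hmem s hs).2.2
    have h5 : a * x * x ≤ q * x := by
      calc a * x * x = a * x ^ 2 := by ring
        _ ≤ q * (∏ p ∈ s, p : ℕ) := h2
        _ ≤ q * x := by gcongr
    exact le_of_mul_le_mul_right h5 hx
  have hfac : ∀ s ∈ S, ∀ q : ℕ, q.Prime → (q * ∏ p ∈ s, p).primeFactors = insert q s := by
    intro s hs q hqp
    rw [Nat.primeFactors_mul hqp.ne_zero (hprod s hs).ne', hqp.primeFactors, hpf s hs,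
      Finset.singleton_union]
  have hns : ∀ s ∈ S, ∀ q : ℕ, y < q → q ∉ s := by
    intro s hs q hyq h
    exact absurd (hP q ((hmem s hs).1 h)).2 (not_le.2 hyq)
  refine Finset.card_le_card_of_injOn (fun z => z.2 * ∏ p ∈ z.1, p) ?_ ?_
  · rintro ⟨s, q⟩ hz
    obtain ⟨hs, hqs⟩ := Finset.mem_sigma.1 hz
    obtain ⟨h1, h2, h3, h4⟩ := hq s hs q hqs
    refine mem_windowA1.2 ⟨h3, h4, ⟨Nat.mul_pos h1.1.pos (hprod s hs), ?_⟩, ?_⟩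
    · intro r hr hrd
      have : r ∈ (q * ∏ p ∈ s, p).primeFactors :=
        Nat.mem_primeFactors.2 ⟨hr, hrd, (Nat.mul_pos h1.1.pos (hprod s hs)).ne'⟩
      rw [hfac s hs q h1.1, Finset.mem_insert] at this
      rcases this with rfl | h
      · exact h1.2
      · exact (hP r ((hmem s hs).1 h)).1.2
    · rw [hfac s hs q h1.1, Finset.card_insert_of_notMem (hns s hs q h2), (hmem s hs).2.1]
  · rintro ⟨s, q⟩ hz ⟨s', q'⟩ hz' h
    obtain ⟨hs, hqs⟩ := Finset.mem_sigma.1 hz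
    obtain ⟨hs', hqs'⟩ := Finset.mem_sigma.1 hz'
    obtain ⟨h1, h2, -⟩ := hq s hs q hqs
    obtain ⟨h1', h2', -⟩ := hq s' hs' q' hqs'
    simp only at h hs hs'
    have hins : insert q s = insert q' s' := by
      rw [← hfac s hs q h1.1, ← hfac s' hs' q' h1'.1, h]
    have hqq : q = q' := by
      have : q ∈ insert q' s' := hins ▸ Finset.mem_insert_self q s
      exact (Finset.mem_insert.1 this).resolve_right (hns s' hs' q h2)
    subst hqq
    have hss : s = s' := by
      rw [← Finset.erase_insert (hns s hs q h2), hins, Finset.erase_insert (hns s' hs' q h2')]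
    rw [hss]

lemma esymmSum_sub_rpow_mul_le {P : Finset ℕ} (hP : ∀ p ∈ P, 0 < p) {x σ : ℝ} (hx : 0 < x)
    (hσ : 0 ≤ σ) (k : ℕ) :
    esymmSum (fun p => (p : ℝ)⁻¹) P k - x ^ (-σ) * esymmSum (fun p => (p : ℝ)⁻¹ * (p : ℝ) ^ σ) P k ≤
      ∑ s ∈ P.powersetCard k with ((∏ p ∈ s, p : ℕ) : ℝ) ≤ x, ((∏ p ∈ s, p : ℕ) : ℝ)⁻¹ := by
  rw [sub_le_iff_le_add, esymmSum, esymmSum, Finset.mul_sum, Finset.sum_filter,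
    ← Finset.sum_add_distrib]
  refine Finset.sum_le_sum fun s hs => ?_
  have hprod : (0 : ℝ) < (∏ p ∈ s, p : ℕ) := by
    exact_mod_cast Finset.prod_pos fun p hp => hP p ((Finset.mem_powersetCard.1 hs).1 hp)
  have h1 : ∏ p ∈ s, (p : ℝ)⁻¹ = ((∏ p ∈ s, p : ℕ) : ℝ)⁻¹ := by
    rw [Finset.prod_inv_distrib, Nat.cast_prod]
  have h2 : ∏ p ∈ s, (p : ℝ) ^ σ = ((∏ p ∈ s, p : ℕ) : ℝ) ^ σ := by
    rw [Nat.cast_prod]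
    exact finsetProd_rpow s _ (fun p _ => by positivity) σ
  rw [Finset.prod_mul_distrib, h1, h2]
  split_ifs with h
  · have : 0 ≤ x ^ (-σ) * (((∏ p ∈ s, p : ℕ) : ℝ)⁻¹ * ((∏ p ∈ s, p : ℕ) : ℝ) ^ σ) := by positivity
    linarith
  · push Not at h
    rw [zero_add, rpow_neg hx.le, mul_left_comm, mul_comm (x ^ σ)⁻¹, ← div_eq_mul_inv,
      ← div_rpow hprod.le hx.le]
    refine le_mul_of_one_le_right (by positivity) (one_le_rpow ?_ hσ)
    rw [one_le_div hx]
    exact h.le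

lemma exists_le_sum_inv_powersetCard {c : ℝ} (hc : 0 < c) :
    ∃ C : ℝ, 0 < C ∧ ∃ δ : ℝ, 0 < δ ∧ δ ≤ 1 / 2 ∧ ∀ᶠ x : ℝ in Filter.atTop, ∃ P : Finset ℕ,
      (∀ p ∈ P, (p.Prime ∧ p % 4 = 1) ∧ (p : ℝ) ≤ x ^ δ) ∧
      ∀ k : ℕ, (k : ℝ) ≤ c * log (log x) →
        C * ((2⁻¹ * log (log x)) ^ k / (k.factorial : ℝ)) ≤
          ∑ s ∈ P.powersetCard k with ((∏ p ∈ s, p : ℕ) : ℝ) ≤ x, ((∏ p ∈ s, p : ℕ) : ℝ)⁻¹ := by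
  obtain ⟨D, hD0, hD⟩ := exists_sum_inv_oneModFour_bounds
  set δ := (8 * c * D + 2)⁻¹ with hδ
  have hδ0 : 0 < δ := by positivity
  have hδ2 : δ ≤ 1 / 2 := by
    rw [hδ, one_div]
    gcongr
    have : 0 ≤ 8 * c * D := by positivity
    linarith
  obtain ⟨s0, hs0⟩ := summable_iff_vanishing_norm.1
    (summable_nat_pow_inv.2 one_lt_two : Summable fun n : ℕ => ((n : ℝ) ^ 2)⁻¹)
    (1 / (64 * c ^ 2)) (by positivity)
  set D0 := ∑ p ∈ s0, (p : ℝ)⁻¹ with hD0def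
  have hD00 : 0 ≤ D0 := Finset.sum_nonneg fun _ _ => by positivity
  have hlδ : log δ < 0 := log_neg hδ0 (by linarith)
  set d := D + D0 - 2⁻¹ * log δ with hd
  have hd0 : 0 < d := by linarith
  refine ⟨exp (-(4 * c * d)) / 2, by positivity, δ, hδ0, hδ2, ?_⟩
  filter_upwards [tendsto_log_log.eventually_gt_atTop (4 * d), Filter.eventually_gt_atTop 1,
    (tendsto_rpow_atTop hδ0).eventually_ge_atTop 3] with x hll hx1 hy3
  have hx0 : 0 < x := by linarith
  have hL : 0 < log x := log_pos hx1
  set Y := 2⁻¹ * log (log x) with hY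
  set y := x ^ δ with hy
  have hly : log y = δ * log x := log_rpow hx0 δ
  have hly0 : 0 < log y := by rw [hly]; positivity
  have hlly : log (log y) = log δ + log (log x) := by rw [hly, log_mul hδ0.ne' hL.ne']
  obtain ⟨hD1, -, hD3⟩ := hD y hy3
  set P := primesOneModFour 0 y \ s0 with hP
  have hPsub : P ⊆ primesOneModFour 0 y := Finset.sdiff_subset
  have hPmem : ∀ p ∈ P, (p.Prime ∧ p % 4 = 1) ∧ (p : ℝ) ≤ y := fun p hp => by
    obtain ⟨h1, -, h3⟩ := mem_primesOneModFour.1 (hPsub hp)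
    exact ⟨h1, h3⟩
  refine ⟨P, hPmem, fun k hk => ?_⟩
  set S := ∑ p ∈ P, (p : ℝ)⁻¹ with hS
  have hSge : Y - d ≤ S := by
    have h1 : ∑ p ∈ primesOneModFour 0 y, (p : ℝ)⁻¹ ≤ S + D0 := by
      calc _ ≤ ∑ p ∈ P ∪ s0, (p : ℝ)⁻¹ := by
            refine Finset.sum_le_sum_of_subset_of_nonneg ?_ fun _ _ _ => by positivity
            rw [hP, Finset.sdiff_union_self_eq_union]
            exact Finset.subset_union_left
        _ = S + D0 := Finset.sum_union Finset.sdiff_disjoint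
    rw [hlly] at hD1
    linarith
  have hYS : Y ≤ 2 * S := by linarith
  have hS0 : 0 < S := by linarith
  have hkS : (k : ℝ) ≤ 4 * c * S := by
    calc (k : ℝ) ≤ c * log (log x) := hk
      _ = 2 * c * Y := by rw [hY]; ring
      _ ≤ 2 * c * (2 * S) := by gcongr
      _ = 4 * c * S := by ring
  have hQ : ∑ p ∈ P, ((p : ℝ)⁻¹) ^ 2 ≤ 1 / (64 * c ^ 2) := by
    simp_rw [inv_pow]
    exact (le_abs_self _).trans (hs0 P Finset.sdiff_disjoint).le
  have hkQ : (k : ℝ) ^ 2 * ∑ p ∈ P, ((p : ℝ)⁻¹) ^ 2 ≤ S ^ 2 / 4 := by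
    calc _ ≤ (4 * c * S) ^ 2 * (1 / (64 * c ^ 2)) := by gcongr
      _ = S ^ 2 / 4 := by field_simp; norm_num
  have hfac : (0 : ℝ) < (k.factorial : ℝ) := by positivity
  have he1 : 3 / 4 * S ^ k ≤ k.factorial * esymmSum (fun p => (p : ℝ)⁻¹) P k := by
    have h1 := pow_mul_sub_le_factorial_mul_esymmSum (w := fun p => (p : ℝ)⁻¹)
      (fun n => by positivity) P k
    rw [← hS] at h1
    have h2 : S ^ k * (3 / 4 * S ^ 2) ≤ S ^ k *
        (S ^ 2 - k ^ 2 * ∑ p ∈ P, ((p : ℝ)⁻¹) ^ 2) := by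
      gcongr
      linarith
    refine le_of_mul_le_mul_right ?_ (pow_pos hS0 2)
    linarith
  set σ := (log y)⁻¹ with hσ
  have hσ0 : 0 < σ := by positivity
  have hw : ∑ p ∈ P, (p : ℝ)⁻¹ * (p : ℝ) ^ σ ≤ S + 2 * D := by
    calc _ ≤ ∑ p ∈ P, ((p : ℝ)⁻¹ + 2 * σ * (log p / p)) := by
          refine Finset.sum_le_sum fun p hp => ?_
          obtain ⟨⟨hpp, -⟩, hpy⟩ := hPmem p hp
          have hp0 : (0 : ℝ) < p := by exact_mod_cast hpp.pos
          have hlp : 0 ≤ log p := log_natCast_nonneg p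
          have h1 : |log p * σ| ≤ 1 := by
            rw [abs_of_nonneg (by positivity), hσ, ← div_eq_mul_inv, div_le_one hly0]
            exact log_le_log hp0 hpy
          have h2 := (abs_le.1 (abs_exp_sub_one_le h1)).2
          rw [abs_of_nonneg (by positivity), ← rpow_def_of_pos hp0] at h2
          calc (p : ℝ)⁻¹ * (p : ℝ) ^ σ ≤ (p : ℝ)⁻¹ * (1 + 2 * (log p * σ)) := by
                gcongr; linarith
            _ = _ := by ring
      _ = S + 2 * σ * ∑ p ∈ P, log p / p := by rw [Finset.sum_add_distrib, Finset.mul_sum]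
      _ ≤ S + 2 * σ * (D * log y) := by
          gcongr
          exact (Finset.sum_le_sum_of_subset_of_nonneg hPsub fun p _ _ =>
            div_nonneg (log_natCast_nonneg p) (by positivity)).trans hD3
      _ = S + 2 * D := by rw [hσ]; field_simp
  have he2 : k.factorial * (x ^ (-σ) * esymmSum (fun p => (p : ℝ)⁻¹ * (p : ℝ) ^ σ) P k) ≤
      1 / 4 * S ^ k := by
    have h1 := factorial_mul_esymmSum_le (w := fun p => (p : ℝ)⁻¹ * (p : ℝ) ^ σ)
      (fun n => by positivity) P k
    have h2 : (∑ p ∈ P, (p : ℝ)⁻¹ * (p : ℝ) ^ σ) ^ k ≤ exp (4 * c * (2 * D)) * S ^ k :=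
      (pow_le_pow_left₀ (Finset.sum_nonneg fun _ _ => by positivity) hw k).trans
        (add_pow_le_pow_mul_exp hS0 (by positivity) hkS)
    have h3 : x ^ (-σ) = exp (-(8 * c * D + 2)) := by
      rw [rpow_def_of_pos hx0]
      congr 1
      rw [hσ, hly, hδ]
      field_simp
    have h4 : exp (-(8 * c * D + 2)) * exp (4 * c * (2 * D)) ≤ 1 / 4 := by
      rw [← exp_add, show -(8 * c * D + 2) + 4 * c * (2 * D) = -(1 + 1) by ring, exp_neg, exp_add,
        one_div]
      have := exp_one_gt_d9
      gcongr
      nlinarith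
    rw [h3]
    calc _ = exp (-(8 * c * D + 2)) * (k.factorial *
          esymmSum (fun p => (p : ℝ)⁻¹ * (p : ℝ) ^ σ) P k) := by ring
      _ ≤ exp (-(8 * c * D + 2)) * (exp (4 * c * (2 * D)) * S ^ k) := by
          exact mul_le_mul_of_nonneg_left (h1.trans h2) (exp_pos _).le
      _ = exp (-(8 * c * D + 2)) * exp (4 * c * (2 * D)) * S ^ k := by ring
      _ ≤ _ := by gcongr
  refine le_trans ?_ (esymmSum_sub_rpow_mul_le (fun p hp => (hPmem p hp).1.1.pos) hx0 hσ0.le k)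
  have h5 : Y ^ k ≤ exp (4 * c * d) * S ^ k := by
    refine (pow_le_pow_left₀ (by linarith) (by linarith : Y ≤ S + d) k).trans
      (add_pow_le_pow_mul_exp hS0 hd0.le hkS)
  rw [mul_div_assoc', div_le_iff₀ hfac]
  calc exp (-(4 * c * d)) / 2 * Y ^ k ≤ exp (-(4 * c * d)) / 2 * (exp (4 * c * d) * S ^ k) := by
        gcongr
    _ = 1 / 2 * S ^ k := by
        rw [exp_neg]; field_simp
    _ ≤ _ := by linarith

lemma exists_le_card_windowA1 {a b c : ℝ} (ha : 0 < a) (hab : a < b) (hc : 0 < c) :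
    ∃ C : ℝ, 0 < C ∧ ∀ᶠ x : ℝ in Filter.atTop, ∀ k : ℕ, (k + 1 : ℝ) ≤ c * log (log x) →
      C * (x ^ 2 / log x) * ((2⁻¹ * log (log x)) ^ k / (k.factorial : ℝ)) ≤
        (windowA1 (k + 1) (a * x ^ 2) (b * x ^ 2)).card := by
  obtain ⟨C, hC, δ, hδ0, hδ2, hev⟩ := exists_le_sum_inv_powersetCard hc
  obtain ⟨c0, hc0, hev0⟩ := exists_le_card_primesOneModFour ha hab
  obtain ⟨T, hT⟩ := Filter.eventually_atTop.1 hev0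
  refine ⟨c0 / 2 * C, by positivity, ?_⟩
  filter_upwards [hev, Filter.eventually_ge_atTop T, Filter.eventually_gt_atTop 1,
    Filter.eventually_gt_atTop (1 / a ^ 2)] with x hx hxT hx1 hxa k hk
  obtain ⟨P, hP, hPk⟩ := hx
  have hx0 : 0 < x := by linarith
  have hL : 0 < log x := log_pos hx1
  have hay : x ^ δ < a * x := by
    calc x ^ δ ≤ x ^ (1 / 2 : ℝ) := rpow_le_rpow_of_exponent_le hx1.le hδ2
      _ = √x := (sqrt_eq_rpow x).symm
      _ < a * x := by
        rw [sqrt_lt' (by positivity)]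
        rw [div_lt_iff₀ (by positivity)] at hxa
        nlinarith
  have h1 := sum_card_primesOneModFour_le_card_windowA1 (b := b) k hP hx0 hay
  have h2 := hPk k (by linarith)
  calc _ = c0 / 2 * (x ^ 2 / log x) * (C * ((2⁻¹ * log (log x)) ^ k / (k.factorial : ℝ))) := by ring
    _ ≤ c0 / 2 * (x ^ 2 / log x) * ∑ s ∈ P.powersetCard k with ((∏ p ∈ s, p : ℕ) : ℝ) ≤ x,
        ((∏ p ∈ s, p : ℕ) : ℝ)⁻¹ := by gcongr
    _ ≤ ((∑ s ∈ P.powersetCard k with ((∏ p ∈ s, p : ℕ) : ℝ) ≤ x,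
      (primesOneModFour (a * (x ^ 2 / (∏ p ∈ s, p : ℕ)))
        (b * (x ^ 2 / (∏ p ∈ s, p : ℕ)))).card : ℕ) : ℝ) := by
        rw [Finset.mul_sum, Nat.cast_sum]
        refine Finset.sum_le_sum fun s hs => ?_
        obtain ⟨hsP, hsx⟩ := Finset.mem_filter.1 hs
        have hpos : 0 < ∏ p ∈ s, p :=
          Finset.prod_pos fun p hp => (hP p ((Finset.mem_powersetCard.1 hsP).1 hp)).1.1.pos
        set m := ∏ p ∈ s, p with hm
        have hm1 : (1 : ℝ) ≤ m := by exact_mod_cast hpos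
        have ht : x ≤ x ^ 2 / m := by
          rw [le_div_iff₀ (by linarith)]
          nlinarith
        have hlt : log (x ^ 2 / m) ≤ 2 * log x := by
          have : log (x ^ 2) = 2 * log x := by rw [log_pow]; norm_num
          rw [← this]
          exact log_le_log (by positivity) (div_le_self (by positivity) hm1)
        have hlt0 : 0 < log (x ^ 2 / m) := log_pos (by linarith)
        refine le_trans ?_ (hT (x ^ 2 / m) (by linarith))
        calc _ = c0 * (x ^ 2 / m / (2 * log x)) := by field_simp
          _ ≤ _ := by gcongr
    _ ≤ _ := by exact_mod_cast h1

theorem stmt_6 (a b c : ℝ) (ha : 0 < a) (hab : a < b) (hc : 0 < c) :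
    ∃ C₁ C₂ Λ₀ : ℝ, 0 < C₁ ∧ 0 < C₂ ∧ 0 < Λ₀ ∧
      ∀ Λ : ℝ, Λ₀ ≤ Λ → ∀ K : ℕ, 0 < K → (K : ℝ) ≤ c * Real.log (Real.log Λ) →
        C₁ * (Λ ^ 2 / Real.log Λ) *
            ((2⁻¹ * Real.log (Real.log Λ)) ^ (K - 1) / (Nat.factorial (K - 1) : ℝ)) ≤
          (({ℓ : ℕ | a * Λ ^ 2 ≤ (ℓ : ℝ) ∧ (ℓ : ℝ) ≤ b * Λ ^ 2 ∧ ℓ ∈ A1 ∧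
              ℓ.primeFactors.card = K}).ncard : ℝ) ∧
        (({ℓ : ℕ | a * Λ ^ 2 ≤ (ℓ : ℝ) ∧ (ℓ : ℝ) ≤ b * Λ ^ 2 ∧ ℓ ∈ A1 ∧
              ℓ.primeFactors.card = K}).ncard : ℝ) ≤
          C₂ * (Λ ^ 2 / Real.log Λ) *
            ((2⁻¹ * Real.log (Real.log Λ)) ^ (K - 1) / (Nat.factorial (K - 1) : ℝ)) := by
  obtain ⟨C₁, hC₁, h₁⟩ := exists_le_card_windowA1 ha hab hc
  obtain ⟨C₂, hC₂, h₂⟩ := exists_card_windowA1_le (c := c) ha (ha.trans hab)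
  obtain ⟨T, hT⟩ := Filter.eventually_atTop.1 (h₁.and h₂)
  refine ⟨C₁, C₂, max T 1, hC₁, hC₂, by positivity, fun Λ hΛ K hK hKc => ?_⟩
  obtain ⟨k, rfl⟩ := Nat.exists_eq_add_one.2 hK
  have hset : {ℓ : ℕ | a * Λ ^ 2 ≤ (ℓ : ℝ) ∧ (ℓ : ℝ) ≤ b * Λ ^ 2 ∧ ℓ ∈ A1 ∧
      ℓ.primeFactors.card = k + 1} = ↑(windowA1 (k + 1) (a * Λ ^ 2) (b * Λ ^ 2)) := by
    ext ℓ
    rw [Finset.mem_coe, mem_windowA1, Set.mem_ofPred_eq]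
  rw [hset, Set.ncard_coe_finset, Nat.add_sub_cancel]
  rw [Nat.cast_add_one] at hKc
  obtain ⟨hl, hu⟩ := hT Λ ((le_max_left _ _).trans hΛ)
  exact ⟨hl k hKc, hu k hKc⟩
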